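/- arXiv:1907.11905 — 3 statements merged into one kernel-verified Lean document; each statement's English description precedes it below -/
import Mathlib

section
/- Let k ≥ 4 be an integer and let R be a k-ring. Then the chromatic number of R equals the maximum, over all k-hyperholes H that are induced subgraphs of R, of the chromatic number of H. (In particular, R contains at least one k-hyperhole as an induced subgraph, and some such hyperhole H satisfies χ(H) = χ(R).) -/
open SimpleGraph

/-- The closed neighborhood `N_G[v]` of a vertex `v`. -/
def closedNbhd {V : Type} (G : SimpleGraph V) (v : V) : Set V :=
  insert v (G.neighborSet v)

/-- `X` (indexed cyclically by `ZMod k`) is a ring partition of `G`: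
a partition into `k` nonempty sets, each of which can be ordered so that the
closed neighborhoods are nested, with the last one covering `X i` and the first
one being exactly `X (i-1) ∪ X i ∪ X (i+1)`. -/
def IsRingPartition {V : Type} (G : SimpleGraph V) (k : ℕ) (X : ZMod k → Set V) : Prop :=
  (∀ i, (X i).Nonempty) ∧
  (∀ v : V, ∃! i, v ∈ X i) ∧
  ∀ i, ∃ (m : ℕ) (hm : 0 < m) (u : Fin m → V),
    Function.Injective u ∧
    Set.range u = X i ∧
    (∀ j j' : Fin m, j ≤ j' → closedNbhd G (u j') ⊆ closedNbhd G (u j)) ∧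
    X i ⊆ closedNbhd G (u ⟨m - 1, by omega⟩) ∧
    closedNbhd G (u ⟨0, hm⟩) = X (i - 1) ∪ X i ∪ X (i + 1)

/-- `G` is a `k`-ring. -/
def IsRing {V : Type} (G : SimpleGraph V) (k : ℕ) : Prop :=
  ∃ X : ZMod k → Set V, IsRingPartition G k X

/-- `X` is a hyperhole partition of `G`: a partition into `k` nonempty cliques,
each complete to the two neighboring cliques and anticomplete to all remaining
vertices. -/
def IsHyperholePartition {V : Type} (G : SimpleGraph V) (k : ℕ) (X : ZMod k → Set V) : Prop :=
  (∀ i, (X i).Nonempty) ∧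
  (∀ v : V, ∃! i, v ∈ X i) ∧
  (∀ i, G.IsClique (X i)) ∧
  (∀ i, ∀ x ∈ X i, ∀ y ∈ X (i - 1) ∪ X (i + 1), G.Adj x y) ∧
  (∀ i, ∀ x ∈ X i, ∀ y, y ∉ X (i - 1) ∪ X i ∪ X (i + 1) → ¬ G.Adj x y)

/-- `G` is a `k`-hyperhole. -/
def IsHyperhole {V : Type} (G : SimpleGraph V) (k : ℕ) : Prop :=
  ∃ X : ZMod k → Set V, IsHyperholePartition G k X

/-- `X` is a hyperantihole partition of `G`: a partition into `k` nonempty cliques,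
each complete to all vertices outside the two neighboring cliques (and itself),
and anticomplete to the two neighboring cliques. -/
def IsHyperantiholePartition {V : Type} (G : SimpleGraph V) (k : ℕ) (X : ZMod k → Set V) : Prop :=
  (∀ i, (X i).Nonempty) ∧
  (∀ v : V, ∃! i, v ∈ X i) ∧
  (∀ i, G.IsClique (X i)) ∧
  (∀ i, ∀ x ∈ X i, ∀ y, y ∉ X (i - 1) ∪ X i ∪ X (i + 1) → G.Adj x y) ∧
  (∀ i, ∀ x ∈ X i, ∀ y ∈ X (i - 1) ∪ X (i + 1), ¬ G.Adj x y)

/-- `G` is a `k`-hyperantihole. -/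
def IsHyperantihole {V : Type} (G : SimpleGraph V) (k : ℕ) : Prop :=
  ∃ X : ZMod k → Set V, IsHyperantiholePartition G k X

/-- A vertex is simplicial if its neighborhood is a clique. -/
def IsSimplicial {V : Type} (G : SimpleGraph V) (v : V) : Prop :=
  G.IsClique (G.neighborSet v)

/-- A graph is perfect if every induced subgraph has chromatic number equal to
its clique number. -/
def IsPerfect {V : Type} (G : SimpleGraph V) : Prop :=
  ∀ S : Set V, (G.induce S).chromaticNumber = ((G.induce S).cliqueNum : ℕ∞)

/-- The function `f_k`: `⌊kn/(k-1)⌋` if `n ≡ 0, 1 (mod k-1)`, and `⌈kn/(k-1)⌉`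
otherwise. -/
def ringF (k n : ℕ) : ℕ :=
  if n % (k - 1) ≤ 1 then k * n / (k - 1) else (k * n + (k - 2)) / (k - 1)

/-- The function `g_k`: `⌊kn/(k-1)⌋` if `n mod (k-1) ∈ {0, …, (k-3)/2}`, and
`⌈kn/(k-1)⌉` if `n mod (k-1) ∈ {(k-1)/2, …, k-2}`. -/
def ringG (k n : ℕ) : ℕ :=
  if n % (k - 1) ≤ (k - 3) / 2 then k * n / (k - 1) else (k * n + (k - 2)) / (k - 1)

/-- The function `f_T`: `⌊5n/4⌋` if `n ≡ 0, 1 (mod 4)`, and `⌈5n/4⌉` if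
`n ≡ 2, 3 (mod 4)`. -/
def fT (n : ℕ) : ℕ :=
  if n % 4 ≤ 1 then 5 * n / 4 else (5 * n + 3) / 4

/-- `G` contains the complete graph `K_m` as a minor, witnessed by `m` pairwise
disjoint nonempty branch sets, each inducing a connected subgraph, with an edge
between every two of them. -/
def HasCompleteMinor {V : Type} (G : SimpleGraph V) (m : ℕ) : Prop :=
  ∃ S : Fin m → Set V,
    (∀ i, (S i).Nonempty) ∧
    (∀ i j, i ≠ j → Disjoint (S i) (S j)) ∧
    (∀ i, (G.induce (S i)).Connected) ∧
    (∀ i j, i ≠ j → ∃ x ∈ S i, ∃ y ∈ S j, G.Adj x y)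

/-- First-fit colouring of `0, 1, 2, …`: the vertex `b` receives the least colour outside `F b`
that no smaller vertex has received. -/
noncomputable def firstFit (F : ℕ → Set ℕ) (b : ℕ) : ℕ :=
  sInf {c | c ∉ F b ∧ ∀ b' : Fin b, c ≠ firstFit F b'}
termination_by b
decreasing_by exact b'.isLt

theorem mem_or_eq_of_lt_firstFit {F : ℕ → Set ℕ} {b c : ℕ} (hc : c < firstFit F b) :
    c ∈ F b ∨ ∃ b' < b, firstFit F b' = c := by
  rw [firstFit] at hc
  have h := Nat.notMem_of_lt_sInf hc
  by_contra! hcon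
  exact h ⟨hcon.1, fun b' => (hcon.2 b' b'.isLt).symm⟩

theorem exists_lt_available {F : ℕ → Set ℕ} {p : ℕ → ℕ} {r b : ℕ} (hb : b < r)
    (hF : ∀ c ∈ F b, ∃ a, a + b + 2 ≤ r ∧ p a = c) :
    ∃ c < r, c ∉ F b ∧ ∀ b' : Fin b, c ≠ firstFit F b' := by
  classical
  set used : Finset ℕ :=
    (Finset.range (r - b - 1)).image p ∪ (Finset.range b).image (firstFit F) with hused
  have hcard : used.card < (Finset.range r).card := by
    rw [hused]
    have h1 := Finset.card_union_le ((Finset.range (r - b - 1)).image p)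
      ((Finset.range b).image (firstFit F))
    have h2 := Finset.card_image_le (s := Finset.range (r - b - 1)) (f := p)
    have h3 := Finset.card_image_le (s := Finset.range b) (f := firstFit F)
    simp only [Finset.card_range] at h2 h3 ⊢
    omega
  obtain ⟨c, hc, hcu⟩ := Finset.exists_mem_notMem_of_card_lt_card hcard
  refine ⟨c, Finset.mem_range.1 hc, fun hcF => hcu ?_, fun b' hcb => hcu ?_⟩
  · obtain ⟨a, ha, rfl⟩ := hF c hcF
    exact Finset.mem_union_left _ (Finset.mem_image_of_mem _ (Finset.mem_range.2 (by omega)))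
  · rw [hcb]
    exact Finset.mem_union_right _ (Finset.mem_image_of_mem _ (Finset.mem_range.2 b'.isLt))

theorem firstFit_spec {F : ℕ → Set ℕ} {p : ℕ → ℕ} {r b : ℕ} (hb : b < r)
    (hF : ∀ c ∈ F b, ∃ a, a + b + 2 ≤ r ∧ p a = c) :
    firstFit F b < r ∧ firstFit F b ∉ F b ∧ ∀ b' < b, firstFit F b ≠ firstFit F b' := by
  obtain ⟨c, hcr, hc⟩ := exists_lt_available hb hF
  have hmem : firstFit F b ∈ {c | c ∉ F b ∧ ∀ b' : Fin b, c ≠ firstFit F b'} := by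
    have heq : firstFit F b = sInf {c | c ∉ F b ∧ ∀ b' : Fin b, c ≠ firstFit F b'} := by
      rw [firstFit]
    rw [heq]
    exact Nat.sInf_mem ⟨c, hc⟩
  refine ⟨lt_of_le_of_lt ?_ hcr, hmem.1, fun b' hb' => hmem.2 ⟨b', hb'⟩⟩
  rw [firstFit]
  exact Nat.sInf_le hc

/-- If first-fit uses colours `≥ y` on the first `z` vertices, then the colours below `y` are
exhausted by the earlier vertices and the forbidden set at some vertex `b < z`. -/
theorem firstFit_card_le {F : ℕ → Set ℕ} {z y : ℕ}
    (hpos : ((Finset.range z).filter (fun b => y ≤ firstFit F b)).card ≠ 0) :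
    ∃ b < z, ∀ T : Finset ℕ, (∀ c ∈ F b, c < y → c ∈ T) →
      ((Finset.range z).filter (fun b => y ≤ firstFit F b)).card + y ≤ b + 1 + T.card := by
  classical
  set B := (Finset.range z).filter (fun b => y ≤ firstFit F b) with hB
  have hne : B.Nonempty := Finset.card_ne_zero.1 hpos
  have hmax := B.max'_mem hne
  set b := B.max' hne with hbdef
  have hbz : b < z := Finset.mem_range.1 (Finset.mem_filter.1 hmax).1
  have hby : y ≤ firstFit F b := (Finset.mem_filter.1 hmax).2
  refine ⟨b, hbz, fun T hT => ?_⟩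
  have h1 : B.card ≤ ((Finset.range b).filter (fun b => y ≤ firstFit F b)).card + 1 := by
    refine (Finset.card_le_card (t := insert b ((Finset.range b).filter
      (fun b => y ≤ firstFit F b))) fun a ha => ?_).trans (Finset.card_insert_le _ _)
    have hab : a ≤ b := B.le_max' a ha
    rcases hab.eq_or_lt with rfl | hlt
    · exact Finset.mem_insert_self _ _
    · exact Finset.mem_insert_of_mem
        (Finset.mem_filter.2 ⟨Finset.mem_range.2 hlt, (Finset.mem_filter.1 ha).2⟩)
  have h2 : y ≤ ((Finset.range b).filter (fun b => ¬ y ≤ firstFit F b)).card + T.card := by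
    have hsub : Finset.range y ⊆
        ((Finset.range b).filter (fun b => ¬ y ≤ firstFit F b)).image (firstFit F) ∪ T := by
      intro c hc
      have hcy := Finset.mem_range.1 hc
      rcases mem_or_eq_of_lt_firstFit (hcy.trans_le hby) with hcF | ⟨b', hb', rfl⟩
      · exact Finset.mem_union_right _ (hT c hcF hcy)
      · exact Finset.mem_union_left _ (Finset.mem_image_of_mem _
          (Finset.mem_filter.2 ⟨Finset.mem_range.2 hb', by omega⟩))
    have := (Finset.card_le_card hsub).trans (Finset.card_union_le _ _)
    rw [Finset.card_range] at this
    exact this.trans (Nat.add_le_add_right Finset.card_image_le _)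
  have h3 := Finset.card_filter_add_card_filter_not (s := Finset.range b)
    (fun b => y ≤ firstFit F b)
  rw [Finset.card_range] at h3
  omega

/-- Colour the levels of position `0` decreasingly, and then each further position by first-fit
with respect to the reversal `c ↦ r - 1 - c` of the colours of the preceding position. Here
`E i a b` says that level `a` at position `i` is adjacent to level `b` at position `i + 1`. -/
noncomputable def alternatingFit (r : ℕ) (E : ℕ → ℕ → ℕ → Prop) : ℕ → ℕ → ℕ
  | 0 => fun a => r - 1 - a
  | i + 1 => firstFit fun b => {c | ∃ a, E i a b ∧ r - 1 - alternatingFit r E i a = c}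

section Levels

variable {r : ℕ} {E : ℕ → ℕ → ℕ → Prop}

theorem alternatingFit_succ_spec (hE : ∀ i a b, E i a b → a + b + 2 ≤ r) {i b : ℕ} (hb : b < r) :
    alternatingFit r E (i + 1) b < r ∧
      (∀ a, E i a b → r - 1 - alternatingFit r E i a ≠ alternatingFit r E (i + 1) b) ∧
      ∀ b' < b, alternatingFit r E (i + 1) b ≠ alternatingFit r E (i + 1) b' := by
  obtain ⟨h1, h2, h3⟩ := firstFit_spec
    (F := fun b => {c | ∃ a, E i a b ∧ r - 1 - alternatingFit r E i a = c})
    (p := fun a => r - 1 - alternatingFit r E i a) hb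
    (fun c ⟨a, ha, hc⟩ => ⟨a, hE i a b ha, hc⟩)
  exact ⟨h1, fun a ha hc => h2 ⟨a, ha, hc⟩, h3⟩

theorem alternatingFit_lt (hE : ∀ i a b, E i a b → a + b + 2 ≤ r) {i a : ℕ} (ha : a < r) :
    alternatingFit r E i a < r := by
  cases i with
  | zero => simp only [alternatingFit]; omega
  | succ i => exact (alternatingFit_succ_spec hE ha).1

theorem alternatingFit_injOn (hE : ∀ i a b, E i a b → a + b + 2 ≤ r) (i : ℕ) :
    Set.InjOn (alternatingFit r E i) (Set.Iio r) := by
  intro a ha b hb hab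
  simp only [Set.mem_Iio] at ha hb
  cases i with
  | zero => simp only [alternatingFit] at hab; omega
  | succ i =>
    rcases lt_trichotomy a b with h | h | h
    · exact absurd hab.symm ((alternatingFit_succ_spec hE hb).2.2 a h)
    · exact h
    · exact absurd hab ((alternatingFit_succ_spec hE ha).2.2 b h)

/-- The number of the first `z` levels at position `i` whose colour is at least `y`. -/
noncomputable def countGE (r : ℕ) (E : ℕ → ℕ → ℕ → Prop) (i z y : ℕ) : ℕ :=
  ((Finset.range z).filter (fun a => y ≤ alternatingFit r E i a)).card

theorem countGE_succ (hE : ∀ i a b, E i a b → a + b + 2 ≤ r)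
    (hmono : ∀ i a b a' b', E i a b → a' ≤ a → b' ≤ b → E i a' b') {i z y : ℕ} (hy : y ≤ r)
    (hpos : countGE r E (i + 1) z y ≠ 0) :
    ∃ b < z, ∃ x ≤ r, (∀ a < x, E i a b) ∧
      countGE r E (i + 1) z y + y ≤ b + 1 + countGE r E i x (r - y) := by
  classical
  obtain ⟨b, hbz, hb⟩ := firstFit_card_le hpos
  have hex : ∃ x, ¬ E i x b := ⟨r, fun h => by have := hE i r b h; omega⟩
  refine ⟨b, hbz, Nat.find hex, Nat.find_min' hex (fun h => by have := hE i r b h; omega),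
    fun a ha => not_not.1 (Nat.find_min hex ha), ?_⟩
  refine (hb (((Finset.range (Nat.find hex)).filter
    (fun a => r - y ≤ alternatingFit r E i a)).image (fun a => r - 1 - alternatingFit r E i a))
    ?_).trans (Nat.add_le_add_left Finset.card_image_le _)
  rintro c ⟨a, ha, rfl⟩ hcy
  have har := hE i a b ha
  have := alternatingFit_lt hE (i := i) (show a < r by omega)
  refine Finset.mem_image_of_mem _ (Finset.mem_filter.2 ⟨Finset.mem_range.2 ?_, by omega⟩)
  by_contra! hle
  exact Nat.find_spec hex (hmono i a b _ b ha hle le_rfl)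

/-- `h` chooses a number of initial levels at each of the positions `0, …, i` so that the levels
chosen at consecutive positions are completely adjacent. -/
def IsLevelPath (r : ℕ) (E : ℕ → ℕ → ℕ → Prop) (i : ℕ) (h : ℕ → ℕ) : Prop :=
  (∀ j, h j ≤ r) ∧ ∀ j < i, h j = 0 ∨ h (j + 1) = 0 ∨ E j (h j - 1) (h (j + 1) - 1)

theorem IsLevelPath.extend {i b x : ℕ} {h : ℕ → ℕ} (hh : IsLevelPath r E i h) (hx : h i ≤ x)
    (hb : b < r) (hxb : ∀ a < x, E i a b) :
    ∃ h', IsLevelPath r E (i + 1) h' ∧ h' 0 = h 0 ∧ h' (i + 1) = b + 1 ∧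
      ∑ j ∈ Finset.range (i + 2), h' j = ∑ j ∈ Finset.range (i + 1), h j + (b + 1) := by
  have hne : ∀ j < i + 1, Function.update h (i + 1) (b + 1) j = h j := fun j hj =>
    Function.update_of_ne (by omega) _ _
  refine ⟨Function.update h (i + 1) (b + 1), ⟨fun j => ?_, fun j hj => ?_⟩, hne 0 (by omega),
    Function.update_self _ _ _, ?_⟩
  · by_cases hj : j = i + 1
    · subst hj; rw [Function.update_self]; omega
    · rw [Function.update_of_ne hj]; exact hh.1 j
  · rw [hne j hj]
    rcases Nat.lt_succ_iff_lt_or_eq.1 hj with hlt | rfl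
    · rw [hne (j + 1) (by omega)]; exact hh.2 j hlt
    · rw [Function.update_self]
      by_cases h0 : h j = 0
      · exact Or.inl h0
      · exact Or.inr (Or.inr (hxb _ (by omega)))
  · rw [Finset.sum_range_succ, Function.update_self]
    congr 1
    exact Finset.sum_congr rfl fun j hj => hne j (Finset.mem_range.1 hj)

theorem sum_range_ite_even (r s : ℕ) :
    ∑ j ∈ Finset.range (2 * s), (if j % 2 = 0 then 0 else r) = s * r := by
  induction s with
  | zero => simp
  | succ s ih =>
    rw [show 2 * (s + 1) = 2 * s + 1 + 1 by ring, Finset.sum_range_succ, Finset.sum_range_succ, ih,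
      if_pos (by omega), if_neg (by omega)]
    ring

theorem exists_levelPath_of_even (Y : ℕ) (s : ℕ) :
    ∃ h, IsLevelPath r E (2 * s) h ∧ h 0 ≤ Y ∧ h (2 * s) = 0 ∧
      ∑ j ∈ Finset.range (2 * s + 1), h j = s * r := by
  refine ⟨fun j => if j % 2 = 0 then 0 else r, ⟨fun j => ?_, fun j _ => ?_⟩, by simp,
    if_pos (by omega), ?_⟩
  · dsimp only; split_ifs <;> omega
  · dsimp only
    rcases Nat.mod_two_eq_zero_or_one j with hj | hj
    · exact Or.inl (if_pos hj)
    · exact Or.inr (Or.inl (if_pos (by omega)))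
  · rw [Finset.sum_range_succ, sum_range_ite_even, if_pos (by omega), add_zero]

theorem exists_levelPath_of_odd {Y : ℕ} (hY : Y ≤ r) (s : ℕ) :
    ∃ h, IsLevelPath r E (2 * s + 1) h ∧ h 0 = Y ∧ h (2 * s + 1) = 0 ∧
      ∑ j ∈ Finset.range (2 * s + 2), h j = Y + s * r := by
  refine ⟨fun j => if j = 0 then Y else if j % 2 = 0 then r else 0,
    ⟨fun j => ?_, fun j _ => ?_⟩, by simp, by simp, ?_⟩
  · dsimp only; split_ifs <;> omega
  · dsimp only
    rcases Nat.mod_two_eq_zero_or_one j with hj | hj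
    · exact Or.inr (Or.inl (by rw [if_neg (by omega), if_neg (by omega)]))
    · exact Or.inl (by rw [if_neg (by omega), if_neg (by omega)])
  · have hshift : ∀ j, (if j + 1 = 0 then Y else if (j + 1) % 2 = 0 then r else 0) =
        if j % 2 = 0 then 0 else r := by
      intro j
      rw [if_neg (by omega)]
      split_ifs <;> omega
    rw [Finset.sum_range_succ', Finset.sum_congr rfl fun j _ => hshift j, Finset.sum_range_succ,
      sum_range_ite_even, if_pos (by omega), if_pos rfl]
    ring

theorem exists_levelPath_countGE (hE : ∀ i a b, E i a b → a + b + 2 ≤ r)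
    (hmono : ∀ i a b a' b', E i a b → a' ≤ a → b' ≤ b → E i a' b') {Y : ℕ} (hY : Y ≤ r) (s : ℕ) :
    ∀ z ≤ r, ∃ h, IsLevelPath r E (2 * s) h ∧ h 0 ≤ Y ∧ h (2 * s) ≤ z ∧
      countGE r E (2 * s) z (r - Y) + s * r ≤ ∑ j ∈ Finset.range (2 * s + 1), h j := by
  induction s with
  | zero =>
    intro z hz
    refine ⟨fun _ => min z Y, ⟨fun _ => (min_le_left _ _).trans hz, fun j hj => by omega⟩,
      min_le_right _ _, min_le_left _ _, ?_⟩
    have hsub : (Finset.range z).filter (fun a => r - Y ≤ alternatingFit r E 0 a) ⊆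
        Finset.range (min z Y) := by
      intro a ha
      rw [Finset.mem_filter, Finset.mem_range] at ha
      simp only [alternatingFit] at ha
      exact Finset.mem_range.2 (by omega)
    simpa [countGE] using Finset.card_le_card hsub
  | succ s ih =>
    have hodd : ∀ z ≤ r, ∃ h, IsLevelPath r E (2 * s + 1) h ∧ h 0 ≤ Y ∧ h (2 * s + 1) ≤ z ∧
        countGE r E (2 * s + 1) z Y + Y + s * r ≤ ∑ j ∈ Finset.range (2 * s + 2), h j := by
      intro z hz
      by_cases hpos : countGE r E (2 * s + 1) z Y = 0
      · obtain ⟨h, h1, h2, h3, h4⟩ := exists_levelPath_of_odd (E := E) hY s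
        exact ⟨h, h1, h2.le, by omega, by omega⟩
      · obtain ⟨b, hbz, x, hx, hxb, hle⟩ := countGE_succ hE hmono hY hpos
        obtain ⟨h, h1, h2, h3, h4⟩ := ih x hx
        obtain ⟨h', h1', h2', h3', h4'⟩ := h1.extend h3 (by omega) hxb
        exact ⟨h', h1', by omega, by omega, by omega⟩
    intro z hz
    rw [show 2 * (s + 1) = 2 * s + 1 + 1 by ring]
    by_cases hpos : countGE r E (2 * s + 1 + 1) z (r - Y) = 0
    · obtain ⟨h, h1, h2, h3, h4⟩ := exists_levelPath_of_even (r := r) (E := E) Y (s + 1)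
      rw [show 2 * (s + 1) = 2 * s + 1 + 1 by ring] at h1 h3 h4
      exact ⟨h, h1, h2, by omega, by omega⟩
    · obtain ⟨b, hbz, x, hx, hxb, hle⟩ := countGE_succ hE hmono (Nat.sub_le r Y) hpos
      rw [Nat.sub_sub_self hY] at hle
      obtain ⟨h, h1, h2, h3, h4⟩ := hodd x hx
      obtain ⟨h', h1', h2', h3', h4'⟩ := h1.extend h3 (by omega) hxb
      refine ⟨h', h1', by omega, by omega, ?_⟩
      have h5 : ∑ j ∈ Finset.range (2 * s + 1 + 1 + 1), h' j =
        ∑ j ∈ Finset.range (2 * s + 2), h j + (b + 1) := h4'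
      rw [add_one_mul]
      omega

theorem sum_range_add_two_mul_le {h : ℕ → ℕ} (m s : ℕ)
    (hh : ∀ j, m ≤ j → j + 1 < m + 2 * s → h j + h (j + 1) ≤ r) :
    ∑ j ∈ Finset.range (m + 2 * s), h j ≤ ∑ j ∈ Finset.range m, h j + s * r := by
  induction s with
  | zero => simp
  | succ s ih =>
    have h1 := ih fun j hj hj' => hh j hj (by omega)
    have h2 := hh (m + 2 * s) (by omega) (by omega)
    rw [show m + 2 * (s + 1) = m + 2 * s + 1 + 1 by ring, Finset.sum_range_succ,
      Finset.sum_range_succ, add_one_mul]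
    omega

theorem sum_range_odd_le_of_eq_zero {t : ℕ} {h : ℕ → ℕ}
    (hh : ∀ j < 2 * t, h j + h (j + 1) ≤ r) (hlast : h (2 * t) + h 0 ≤ r)
    {m : ℕ} (hm : m ≤ 2 * t) (hzero : h m = 0) :
    ∑ j ∈ Finset.range (2 * t + 1), h j ≤ t * r := by
  rcases Nat.even_or_odd' m with ⟨c, rfl | rfl⟩
  · have h1 := sum_range_add_two_mul_le (r := r) (h := h) 0 c fun j _ hj => hh j (by omega)
    have h2 := sum_range_add_two_mul_le (r := r) (h := h) (2 * c + 1) (t - c)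
      fun j _ hj => hh j (by omega)
    rw [show 2 * c + 1 + 2 * (t - c) = 2 * t + 1 by omega, Finset.sum_range_succ _ (2 * c)] at h2
    have h3 : c * r + (t - c) * r = t * r := by rw [← add_mul]; congr 1; omega
    simp only [zero_add, Finset.range_zero, Finset.sum_empty] at h1
    omega
  · have h1 := sum_range_add_two_mul_le (r := r) (h := h) 1 c fun j _ hj => hh j (by omega)
    have h2 := sum_range_add_two_mul_le (r := r) (h := h) (2 * c + 1 + 1) (t - c - 1)
      fun j _ hj => hh j (by omega)
    rw [show 2 * c + 1 + 1 + 2 * (t - c - 1) = 2 * t by omega,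
      Finset.sum_range_succ _ (2 * c + 1)] at h2
    have h3 : c * r + (t - c - 1) * r + r = t * r := by
      rw [← add_mul, ← add_one_mul]; congr 1; omega
    rw [Finset.sum_range_succ]
    rw [show 1 + 2 * c = 2 * c + 1 by ring, Finset.sum_range_one] at h1
    omega

/-- The last position of an odd cycle does not conflict with position `0`, unless some cyclic choice
of initial levels is too large. -/
theorem alternatingFit_ne (hE : ∀ i a b, E i a b → a + b + 2 ≤ r)
    (hmono : ∀ i a b a' b', E i a b → a' ≤ a → b' ≤ b → E i a' b') {t : ℕ}
    (hcyc : ∀ h : ℕ → ℕ, (∀ j < 2 * t, E j (h j) (h (j + 1))) → E (2 * t) (h (2 * t)) (h 0) →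
      ∑ j ∈ Finset.range (2 * t + 1), (h j + 1) ≤ t * r) {a b : ℕ} (hab : E (2 * t) a b) :
    alternatingFit r E (2 * t) a ≠ alternatingFit r E 0 b := by
  intro heq
  have habr := hE _ _ _ hab
  obtain ⟨h, ⟨hr, hpath⟩, h0, hlast, hsum⟩ :=
    exists_levelPath_countGE hE hmono (Y := b + 1) (by omega) t (a + 1) (by omega)
  have hpos : 0 < countGE r E (2 * t) (a + 1) (r - (b + 1)) := by
    refine Finset.card_pos.2 ⟨a, Finset.mem_filter.2 ⟨Finset.mem_range.2 (by omega), ?_⟩⟩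
    rw [heq]
    simp only [alternatingFit]
    omega
  have hclose : h (2 * t) = 0 ∨ h 0 = 0 ∨ E (2 * t) (h (2 * t) - 1) (h 0 - 1) :=
    Or.inr (Or.inr (hmono _ _ _ _ _ hab (by omega) (by omega)))
  have hle : ∀ i x y, x ≤ r → y ≤ r → (x = 0 ∨ y = 0 ∨ E i (x - 1) (y - 1)) → x + y ≤ r := by
    rintro i x y hx hy (h | h | h)
    · omega
    · omega
    · have := hE _ _ _ h; omega
  by_cases hz : ∃ m ≤ 2 * t, h m = 0
  · obtain ⟨m, hm, hm0⟩ := hz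
    have := sum_range_odd_le_of_eq_zero (fun j hj => hle j _ _ (hr _) (hr _) (hpath j hj))
      (hle _ _ _ (hr _) (hr _) hclose) hm hm0
    omega
  · push Not at hz
    have hbound := hcyc (fun j => h j - 1)
      (fun j hj => ((hpath j hj).resolve_left (hz j (by omega))).resolve_left (hz _ (by omega)))
      ((hclose.resolve_left (hz _ le_rfl)).resolve_left (hz 0 (by omega)))
    have hsub : ∑ j ∈ Finset.range (2 * t + 1), (h j - 1 + 1) =
        ∑ j ∈ Finset.range (2 * t + 1), h j :=
      Finset.sum_congr rfl fun j hj => Nat.sub_add_cancel (Nat.one_le_iff_ne_zero.2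
        (hz j (by have := Finset.mem_range.1 hj; omega)))
    omega

/-- The levels at the positions `0, …, k - 1`, where position `k - 1` is followed by position `0`,
can be coloured with `r` colours. -/
theorem exists_cyclic_coloring (hE : ∀ i a b, E i a b → a + b + 2 ≤ r)
    (hmono : ∀ i a b a' b', E i a b → a' ≤ a → b' ≤ b → E i a' b') {k : ℕ} (hk : 0 < k)
    (hcyc : ∀ h : ℕ → ℕ, (∀ j, j + 1 < k → E j (h j) (h (j + 1))) → E (k - 1) (h (k - 1)) (h 0) →
      ∑ j ∈ Finset.range k, (h j + 1) ≤ r * (k / 2)) :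
    ∃ col : ℕ → ℕ → ℕ, (∀ i, ∀ a < r, col i a < r) ∧ (∀ i, Set.InjOn (col i) (Set.Iio r)) ∧
      (∀ i a b, i + 1 < k → E i a b → col i a ≠ col (i + 1) b) ∧
      ∀ a b, E (k - 1) a b → col (k - 1) a ≠ col 0 b := by
  rcases Nat.even_or_odd' k with ⟨t, rfl | rfl⟩
  · refine ⟨fun i a => if i % 2 = 0 then a else r - 1 - a, fun i a ha => ?_,
      fun i a ha b hb hab => ?_, fun i a b _ hab => ?_, fun a b hab => ?_⟩
    · dsimp only; split_ifs <;> omega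
    · simp only [Set.mem_Iio] at ha hb
      dsimp only at hab
      split_ifs at hab <;> omega
    all_goals
      have := hE _ _ _ hab
      dsimp only
      split_ifs <;> omega
  · have hbr : ∀ {i a b}, E i a b → a < r ∧ b < r := fun h => by
      have := hE _ _ _ h; omega
    refine ⟨fun i a => if i % 2 = 0 then alternatingFit r E i a else r - 1 - alternatingFit r E i a,
      fun i a ha => ?_, fun i a ha b hb hab => ?_, fun i a b _ hab => ?_, fun a b hab => ?_⟩
    · have := alternatingFit_lt hE (i := i) ha
      dsimp only; split_ifs <;> omega
    · have h1 := alternatingFit_lt hE (i := i) ha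
      have h2 := alternatingFit_lt hE (i := i) hb
      refine alternatingFit_injOn hE i ha hb ?_
      dsimp only at hab
      split_ifs at hab <;> omega
    · have h1 := alternatingFit_lt hE (i := i) (hbr hab).1
      have h2 := alternatingFit_succ_spec hE (i := i) (hbr hab).2
      have h3 := h2.2.1 a hab
      dsimp only
      split_ifs <;> omega
    · simp only [Nat.add_sub_cancel, Nat.mul_mod_right, Nat.zero_mod, if_true] at hab ⊢
      refine alternatingFit_ne hE hmono (fun h h1 h2 => ?_) hab
      have := hcyc h (fun j hj => h1 j (by omega)) h2
      rwa [show (2 * t + 1) / 2 = t by omega, mul_comm r] at this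

end Levels

/-- An enumeration of the vertices of a ring witnessing a ring partition: `vert i a` is the vertex
at position `i` and level `a`, and the neighbourhoods shrink as the level grows. -/
structure RingEnumeration {V : Type} (R : SimpleGraph V) (k : ℕ) where
  size : ZMod k → ℕ
  vert : ∀ i, Fin (size i) → V
  size_pos : ∀ i, 0 < size i
  exists_vert : ∀ v, ∃ i a, vert i a = v
  vert_inj : ∀ {i j a b}, vert i a = vert j b → i = j ∧ (a : ℕ) = b
  adj_of_ne : ∀ {i a b}, a ≠ b → R.Adj (vert i a) (vert i b)
  index_of_adj : ∀ {i j a b}, R.Adj (vert i a) (vert j b) → j = i - 1 ∨ j = i ∨ j = i + 1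
  adj_mono : ∀ {i j a a' b}, i ≠ j → a' ≤ a → R.Adj (vert i a) (vert j b) →
    R.Adj (vert i a') (vert j b)
  adj_zero : ∀ {i j b}, j ≠ i → j = i - 1 ∨ j = i + 1 →
    R.Adj (vert i ⟨0, size_pos i⟩) (vert j b)

theorem IsRing.nonempty_ringEnumeration {V : Type} {R : SimpleGraph V} {k : ℕ}
    (hR : IsRing R k) : Nonempty (RingEnumeration R k) := by
  obtain ⟨X, -, huniq, hX⟩ := hR
  choose m hm u hinj hrange hnest hlast hfirst using hX
  have hmem : ∀ i a, u i a ∈ X i := fun i a => hrange i ▸ Set.mem_range_self a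
  have hidx : ∀ {i j v}, v ∈ X i → v ∈ X j → i = j := fun {i j v} hi hj =>
    (huniq v).unique hi hj
  have hne : ∀ {i j a b}, i ≠ j → u i a ≠ u j b := fun {i j a b} hij h =>
    hij (hidx (hmem i a) (h ▸ hmem j b))
  refine ⟨⟨m, u, hm, fun v => ?_, fun {i j a b} h => ?_, fun {i a b} hab => ?_,
    fun {i j a b} h => ?_, fun {i j a a' b} hij ha h => ?_, fun {i j b} hij h => ?_⟩⟩
  · obtain ⟨i, hi, -⟩ := huniq v
    rw [← hrange i] at hi
    exact ⟨i, hi⟩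
  · obtain rfl := hidx (hmem i a) (h ▸ hmem j b)
    exact ⟨rfl, congrArg _ (hinj i h)⟩
  · have h1 : u i b ∈ closedNbhd R (u i a) :=
      hnest i a ⟨m i - 1, by have := hm i; omega⟩ (Fin.le_def.2 (Nat.le_sub_one_of_lt a.isLt))
        (hlast i (hmem i b))
    exact (Set.mem_insert_iff.1 h1).resolve_left fun h => hab (hinj i h).symm
  · have h1 : u j b ∈ closedNbhd R (u i ⟨0, hm i⟩) :=
      hnest i ⟨0, hm i⟩ a (Fin.le_def.2 (Nat.zero_le _)) (Set.mem_insert_of_mem _ h)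
    rw [hfirst i] at h1
    rcases h1 with (h1 | h1) | h1
    · exact Or.inl (hidx (hmem j b) h1)
    · exact Or.inr (Or.inl (hidx (hmem j b) h1))
    · exact Or.inr (Or.inr (hidx (hmem j b) h1))
  · exact (Set.mem_insert_iff.1 (hnest i a' a ha (Set.mem_insert_of_mem _ h))).resolve_left
      (hne hij.symm)
  · have h1 : u j b ∈ closedNbhd R (u i ⟨0, hm i⟩) := by
      rw [hfirst i]
      rcases h with h | h
      · exact Or.inl (Or.inl (h ▸ hmem j b))
      · exact Or.inr (h ▸ hmem j b)
    exact (Set.mem_insert_iff.1 h1).resolve_left (hne hij)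

theorem ZMod.add_natCast_ne_self {k m : ℕ} (hm : 0 < m) (hmk : m < k) (i : ZMod k) :
    i + (m : ZMod k) ≠ i := by
  rw [Ne, add_eq_left, ZMod.natCast_eq_zero_iff]
  exact fun h => absurd (Nat.le_of_dvd hm h) (by omega)

theorem ZMod.sum_val_eq_sum_range {k : ℕ} [NeZero k] (f : ℕ → ℕ) :
    ∑ i : ZMod k, f i.val = ∑ j ∈ Finset.range k, f j := by
  obtain ⟨n, rfl⟩ := Nat.exists_eq_succ_of_ne_zero (NeZero.ne k)
  exact Fin.sum_univ_eq_sum_range f (n + 1)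

/-- Cyclically indexed subsets of an `r`-element set with consecutive ones disjoint have total
size at most `r * ⌊k / 2⌋`. -/
theorem sum_card_le_of_disjoint_succ {k r : ℕ} [NeZero k] (P : ZMod k → Finset (Fin r))
    (hP : ∀ i, Disjoint (P i) (P (i + 1))) : ∑ i, (P i).card ≤ r * (k / 2) := by
  have hswap : ∑ i, (P i).card =
      ∑ c : Fin r, (Finset.univ.filter fun i => c ∈ P i).card := by
    have := Finset.sum_card_bipartiteAbove_eq_sum_card_bipartiteBelow
      (s := (Finset.univ : Finset (ZMod k))) (t := (Finset.univ : Finset (Fin r)))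
      (fun i c => c ∈ P i)
    simpa [Finset.bipartiteAbove, Finset.bipartiteBelow] using this
  rw [hswap]
  refine (Finset.sum_le_card_nsmul _ _ (k / 2) fun c _ => ?_).trans (by simp)
  set A := Finset.univ.filter fun i => c ∈ P i with hA
  have hdisj : Disjoint A (A.map (addRightEmbedding 1)) := by
    rw [Finset.disjoint_left]
    intro i hi hi'
    obtain ⟨j, hj, rfl⟩ := Finset.mem_map.1 hi'
    exact Finset.disjoint_left.1 (hP j) (Finset.mem_filter.1 hj).2 (Finset.mem_filter.1 hi).2
  have hcard := Finset.card_le_univ (A ∪ A.map (addRightEmbedding 1))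
  rw [Finset.card_union_of_disjoint hdisj, Finset.card_map, ZMod.card] at hcard
  omega

namespace RingEnumeration

variable {V : Type} {R : SimpleGraph V} {k : ℕ} (e : RingEnumeration R k)

/-- Level `a` at position `i` is adjacent to level `b` at position `i + 1`. -/
def LevelAdj (i : ZMod k) (a b : ℕ) : Prop :=
  ∃ (ha : a < e.size i) (hb : b < e.size (i + 1)),
    R.Adj (e.vert i ⟨a, ha⟩) (e.vert (i + 1) ⟨b, hb⟩)

/-- The vertices whose level is at most `g i`, where `i` is their position. -/
def levelSet (g : ZMod k → ℕ) : Set V :=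
  {v | ∃ (i : ZMod k) (a : Fin (e.size i)), (a : ℕ) ≤ g i ∧ e.vert i a = v}

variable {e}

theorem LevelAdj.mono (hk : 4 ≤ k) {i : ZMod k} {a b a' b' : ℕ} (h : e.LevelAdj i a b)
    (ha : a' ≤ a) (hb : b' ≤ b) : e.LevelAdj i a' b' := by
  obtain ⟨ha0, hb0, h⟩ := h
  have hne : i + 1 ≠ i := by simpa using ZMod.add_natCast_ne_self one_pos (by omega) i
  exact ⟨ha.trans_lt ha0, hb.trans_lt hb0, (e.adj_mono hne (Fin.mk_le_mk.2 hb)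
    (e.adj_mono hne.symm (Fin.mk_le_mk.2 ha) h).symm).symm⟩

theorem levelAdj_zero_left (hk : 4 ≤ k) {i : ZMod k} {b : ℕ} (hb : b < e.size (i + 1)) :
    e.LevelAdj i 0 b := by
  have hne : i + 1 ≠ i := by simpa using ZMod.add_natCast_ne_self one_pos (by omega) i
  exact ⟨e.size_pos i, hb, e.adj_zero hne (Or.inr rfl)⟩

theorem levelAdj_zero_right (hk : 4 ≤ k) {i : ZMod k} {a : ℕ} (ha : a < e.size i) :
    e.LevelAdj i a 0 := by
  have hne : i + 1 ≠ i := by simpa using ZMod.add_natCast_ne_self one_pos (by omega) i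
  exact ⟨ha, e.size_pos _, (e.adj_zero hne.symm (Or.inl (by ring))).symm⟩

theorem adj_of_le_of_levelAdj (hk : 4 ≤ k) {g : ZMod k → ℕ}
    (hg : ∀ i, e.LevelAdj i (g i) (g (i + 1))) {i j : ZMod k} (hij : j = i + 1)
    {a : Fin (e.size i)} {b : Fin (e.size j)} (ha : a ≤ g i) (hb : b ≤ g j) :
    R.Adj (e.vert i a) (e.vert j b) := by
  subst hij
  exact ((hg i).mono hk ha hb).2.2

theorem isHyperhole_induce_levelSet (hk : 4 ≤ k) {g : ZMod k → ℕ}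
    (hg : ∀ i, e.LevelAdj i (g i) (g (i + 1))) : IsHyperhole (R.induce (e.levelSet g)) k := by
  refine ⟨fun i => {v | ∃ a : Fin (e.size i), (a : ℕ) ≤ g i ∧ e.vert i a = v.1}, fun i => ?_, ?_,
    fun i => ?_, fun i => ?_, fun i => ?_⟩
  · exact ⟨⟨_, i, ⟨g i, (hg i).1⟩, le_rfl, rfl⟩, _, le_rfl, rfl⟩
  · rintro ⟨v, i, a, ha, rfl⟩
    exact ⟨i, ⟨a, ha, rfl⟩, fun j ⟨b, _, hb⟩ => (e.vert_inj hb).1⟩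
  · rintro ⟨_, _⟩ ⟨a, ha, rfl⟩ ⟨_, _⟩ ⟨b, hb, rfl⟩ hne
    exact e.adj_of_ne fun hab => hne (by subst hab; rfl)
  · rintro ⟨_, _⟩ ⟨a, ha, rfl⟩ ⟨_, _⟩ (⟨b, hb, rfl⟩ | ⟨b, hb, rfl⟩)
    · exact (adj_of_le_of_levelAdj hk hg (by ring) hb ha).symm
    · exact adj_of_le_of_levelAdj hk hg rfl ha hb
  · rintro ⟨_, _⟩ ⟨a, ha, rfl⟩ ⟨_, j, b, hb, rfl⟩ hnot hadj
    rcases e.index_of_adj hadj with rfl | rfl | rfl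
    · exact hnot (Or.inl (Or.inl ⟨b, hb, rfl⟩))
    · exact hnot (Or.inl (Or.inr ⟨b, hb, rfl⟩))
    · exact hnot (Or.inr ⟨b, hb, rfl⟩)

theorem exists_colorSets (hk : 4 ≤ k) {g : ZMod k → ℕ}
    (hg : ∀ i, e.LevelAdj i (g i) (g (i + 1))) {r : ℕ}
    (hcol : (R.induce (e.levelSet g)).Colorable r) :
    ∃ P : ZMod k → Finset (Fin r), (∀ i, (P i).card = g i + 1) ∧
      ∀ i, Disjoint (P i) (P (i + 1)) := by
  obtain ⟨c⟩ := hcol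
  have hlt : ∀ i (a : Fin (g i + 1)), (a : ℕ) < e.size i := fun i a =>
    (Nat.le_of_lt_succ a.isLt).trans_lt (hg i).1
  let x : ∀ i, Fin (g i + 1) → e.levelSet g := fun i a =>
    ⟨e.vert i ⟨a, hlt i a⟩, i, _, Nat.le_of_lt_succ a.isLt, rfl⟩
  refine ⟨fun i => Finset.univ.image fun a => c (x i a), fun i => ?_, fun i => ?_⟩
  · rw [Finset.card_image_of_injective, Finset.card_univ, Fintype.card_fin]
    intro a b hab
    by_contra hne
    exact c.valid (v := x i a) (w := x i b)
      (e.adj_of_ne fun h => hne (Fin.ext (Fin.mk.inj_iff.1 h))) hab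
  · rw [Finset.disjoint_left]
    intro d hd hd'
    obtain ⟨a, -, rfl⟩ := Finset.mem_image.1 hd
    obtain ⟨b, -, hb⟩ := Finset.mem_image.1 hd'
    exact c.valid (v := x i a) (w := x (i + 1) b)
      (adj_of_le_of_levelAdj hk hg rfl (Nat.le_of_lt_succ a.isLt) (Nat.le_of_lt_succ b.isLt))
      hb.symm

variable {r : ℕ}

theorem LevelAdj.add_le (hk : 4 ≤ k)
    (hcol : ∀ S : Set V, IsHyperhole (R.induce S) k → (R.induce S).Colorable r)
    {i : ZMod k} {a b : ℕ} (h : e.LevelAdj i a b) : a + b + 2 ≤ r := by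
  have hne : ∀ x : ZMod k, x + 1 ≠ x := fun x => by
    simpa using ZMod.add_natCast_ne_self one_pos (by omega) x
  have hne2 : ∀ x : ZMod k, x + 1 + 1 ≠ x := fun x => by
    simpa [add_assoc, one_add_one_eq_two] using
      ZMod.add_natCast_ne_self (m := 2) two_pos (by omega) x
  let g : ZMod k → ℕ := fun x => if x = i then a else if x = i + 1 then b else 0
  have hgi : g i = a := if_pos rfl
  have hgs : g (i + 1) = b := (if_neg (hne i)).trans (if_pos rfl)
  have hg0 : ∀ x, x ≠ i → x ≠ i + 1 → g x = 0 := fun x h1 h2 =>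
    (if_neg h1).trans (if_neg h2)
  have hgl : ∀ x, g x < e.size x := by
    intro x
    by_cases h1 : x = i
    · subst h1; rw [hgi]; exact h.1
    by_cases h2 : x = i + 1
    · subst h2; rw [hgs]; exact h.2.1
    rw [hg0 x h1 h2]; exact e.size_pos x
  have hg : ∀ x, e.LevelAdj x (g x) (g (x + 1)) := by
    intro x
    by_cases h1 : x = i
    · subst h1; rwa [hgi, hgs]
    by_cases h2 : x = i + 1
    · rw [hg0 (x + 1) (h2 ▸ hne2 i) (h2 ▸ hne _)]
      exact levelAdj_zero_right hk (hgl x)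
    · rw [hg0 x h1 h2]
      exact levelAdj_zero_left hk (hgl _)
  obtain ⟨P, hP, hdisj⟩ := exists_colorSets hk hg (hcol _ (isHyperhole_induce_levelSet hk hg))
  have hcard := Finset.card_le_univ (P i ∪ P (i + 1))
  rw [Finset.card_union_of_disjoint (hdisj i), hP, hP, hgi, hgs, Fintype.card_fin] at hcard
  omega

theorem colorable (hk : 4 ≤ k) (e : RingEnumeration R k)
    (hcol : ∀ S : Set V, IsHyperhole (R.induce S) k → (R.induce S).Colorable r) :
    R.Colorable r := by
  have : NeZero k := ⟨by omega⟩
  have hval : ∀ i : ZMod k, (i.val : ZMod k) = i := ZMod.natCast_zmod_val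
  have hsucc : ∀ i : ZMod k, i.val + 1 < k ∧ (i + 1).val = i.val + 1 ∨
      i.val = k - 1 ∧ (i + 1).val = 0 := by
    intro i
    have hi := i.val_lt
    rcases Nat.lt_or_ge (i.val + 1) k with h | h
    · refine Or.inl ⟨h, ?_⟩
      conv_lhs => rw [← hval i, ← Nat.cast_succ]
      exact ZMod.val_cast_of_lt h
    · refine Or.inr ⟨by omega, ?_⟩
      rw [ZMod.val_eq_zero]
      conv_lhs => rw [← hval i, ← Nat.cast_succ, show i.val.succ = k by omega]
      exact ZMod.natCast_self k
  obtain ⟨col, hlt, hinj, hnext, hwrap⟩ := exists_cyclic_coloring (r := r) (k := k)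
    (E := fun j => e.LevelAdj (j : ZMod k))
    (fun i a b h => h.add_le hk hcol) (fun i a b a' b' h ha hb => h.mono hk ha hb) (by omega)
    (fun h h1 h2 => by
      have hg : ∀ i : ZMod k, e.LevelAdj i (h i.val) (h (i + 1).val) := by
        intro i
        rcases hsucc i with ⟨hi, hs⟩ | ⟨hi, hs⟩
        · simpa only [hs, hval] using h1 i.val hi
        · rw [hs]
          simpa only [← hi, hval] using h2
      obtain ⟨P, hP, hdisj⟩ := exists_colorSets (g := fun i => h i.val) hk hg
        (hcol _ (isHyperhole_induce_levelSet hk hg))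
      rw [← ZMod.sum_val_eq_sum_range fun j => h j + 1]
      simpa only [hP] using sum_card_le_of_disjoint_succ P hdisj)
  have hlevel : ∀ i (a : Fin (e.size i)), (a : ℕ) < r := fun i a => by
    have := (levelAdj_zero_right (e := e) hk a.isLt).add_le hk hcol
    omega
  have hadj : ∀ {i j} {a : Fin (e.size i)} {b : Fin (e.size j)}, j = i + 1 →
      R.Adj (e.vert i a) (e.vert j b) → col i.val a ≠ col j.val b := by
    rintro i _ a b rfl h
    have hl : e.LevelAdj (i.val : ZMod k) a b := by
      rw [hval]
      exact ⟨a.isLt, b.isLt, h⟩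
    rcases hsucc i with ⟨hi, hs⟩ | ⟨hi, hs⟩
    · rw [hs]; exact hnext _ _ _ hi hl
    · rw [hs, hi]; rw [hi] at hl; exact hwrap _ _ hl
  choose idx lvl hvert using e.exists_vert
  refine ⟨Coloring.mk (fun v => ⟨col (idx v).val (lvl v), hlt _ _ (hlevel _ _)⟩) ?_⟩
  intro v w hvw heq
  have heq' : col (idx v).val (lvl v) = col (idx w).val (lvl w) := congrArg Fin.val heq
  have hvw' := hvw
  rw [← hvert v, ← hvert w] at hvw'
  rcases e.index_of_adj hvw' with h | h | h
  · exact hadj (by rw [h]; ring) hvw'.symm heq'.symm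
  · have hl := hinj _ (hlevel _ _) (hlevel _ _)
      (heq'.trans (congrArg (fun x => col x.val (lvl w : ℕ)) h))
    have hvert_eq : ∀ {i j} {a : Fin (e.size i)} {b : Fin (e.size j)}, j = i → (a : ℕ) = b →
        e.vert i a = e.vert j b := by
      rintro i _ a b rfl hab
      rw [Fin.ext hab]
    exact hvw'.ne (hvert_eq h hl)
  · exact hadj h hvw' heq'

end RingEnumeration

/-- The chromatic number of a `k`-ring equals the maximum chromatic number of a
`k`-hyperhole that is an induced subgraph of it: some induced `k`-hyperhole attains
`χ(R)`, and every induced `k`-hyperhole has chromatic number at most `χ(R)`. -/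
theorem ring_chromaticNumber_eq_max_hyperhole {V : Type} [Fintype V]
    (k : ℕ) (hk : 4 ≤ k) (R : SimpleGraph V) (hR : IsRing R k) :
    (∃ S : Set V, IsHyperhole (R.induce S) k ∧
      (R.induce S).chromaticNumber = R.chromaticNumber) ∧
    (∀ S : Set V, IsHyperhole (R.induce S) k →
      (R.induce S).chromaticNumber ≤ R.chromaticNumber) := by
  refine ⟨?_, fun S _ => chromaticNumber_mono_of_hom (Embedding.induce S).toHom⟩
  obtain ⟨e⟩ := hR.nonempty_ringEnumeration
  have : Nonempty V := ⟨e.vert 0 ⟨0, e.size_pos 0⟩⟩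
  by_contra! hcon
  obtain ⟨n, hn⟩ := ENat.ne_top_iff_exists.1
    (chromaticNumber_ne_top_iff_exists.2 ⟨_, R.colorable_of_fintype⟩)
  have hpos : 0 < n := by
    have := R.colorable_of_fintype.chromaticNumber_pos
    rw [← hn] at this
    exact_mod_cast this
  have hR' : R.Colorable (n - 1) := RingEnumeration.colorable hk e fun S hS => by
    have hlt := lt_of_le_of_ne (chromaticNumber_mono_of_hom (Embedding.induce (G := R) S).toHom)
      (hcon S hS)
    rw [← chromaticNumber_le_iff_colorable]
    rw [← hn, ← Nat.sub_add_cancel hpos, Nat.cast_succ] at hlt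
    exact ENat.lt_add_one_iff (ENat.natCast_ne_top _) |>.1 hlt
  have := hR'.chromaticNumber_le
  rw [← hn] at this
  have : n ≤ n - 1 := by exact_mod_cast this
  omega
end

section
/- Let k ≥ 4 be an integer and let R be a k-ring. Then χ(R) = max({ω(R)} ∪ {⌈|V(H)| / ⌊k/2⌋⌉ : H is a k-hyperhole that is an induced subgraph of R}). -/
open SimpleGraph

/-- Positions of the vertices of a ring: the index of the layer of a vertex, and its rank within
the nested ordering of that layer. -/
structure RingLayout {V : Type} (R : SimpleGraph V) (k : ℕ) where
  lay : V → ℕ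
  pos : V → ℕ
  lay_lt : ∀ v, lay v < k
  adj_of_lay_eq : ∀ v w, v ≠ w → lay v = lay w → R.Adj v w
  lay_of_adj : ∀ v w, R.Adj v w →
    lay w = lay v ∨ (lay v + 1) % k = lay w ∨ (lay w + 1) % k = lay v
  adj_of_le : ∀ v v' w, lay v' = lay v → pos v' ≤ pos v → v' ≠ w → R.Adj v w → R.Adj v' w
  pos_inj : ∀ v w, lay v = lay w → pos v = pos w → v = w
  exists_pos : ∀ v, ∀ j ≤ pos v, ∃ w, lay w = lay v ∧ pos w = j

lemma ZMod.eq_add_one_iff_val {k : ℕ} [NeZero k] (i j : ZMod k) :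
    j = i + 1 ↔ (i.val + 1) % k = j.val := by
  rw [← (ZMod.val_injective k).eq_iff, ZMod.val_add, ZMod.val_one_eq_one_mod, Nat.add_mod_mod]
  exact eq_comm

lemma IsRing.nonempty_layout {V : Type} {R : SimpleGraph V} {k : ℕ} (hk : k ≠ 0)
    (hR : IsRing R k) : Nonempty (RingLayout R k) := by
  have : NeZero k := ⟨hk⟩
  obtain ⟨X, -, hpart, hord⟩ := hR
  choose m hm u hinj hrange hnest hlast hfirst using hord
  choose idx hidx hidx' using hpart
  have hidx' : ∀ v i, v ∈ X i → i = idx v := hidx'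
  have hex : ∀ v, ∃ j, u (idx v) j = v := fun v => by
    have : v ∈ X (idx v) := hidx v
    rw [← hrange] at this
    exact this
  choose p hp using hex
  have hu : ∀ i j, idx (u i j) = i := fun i j =>
    (hidx' _ _ (by rw [← hrange]; exact ⟨j, rfl⟩)).symm
  have hpu : ∀ i j, (p (u i j)).val = j.val := by
    intro i j
    have key : ∀ i' (q : Fin (m i')), i' = i → u i' q = u i j → q.val = j.val := by
      rintro i' q rfl h
      rw [hinj _ h]
    exact key _ _ (hu i j) (hp _)
  have hnest' : ∀ v v', idx v' = idx v → (p v').val ≤ (p v).val →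
      closedNbhd R v ⊆ closedNbhd R v' := by
    intro v v' h hle
    have key : ∀ i (q : Fin (m i)), i = idx v → q.val ≤ (p v).val →
        closedNbhd R (u (idx v) (p v)) ⊆ closedNbhd R (u i q) := by
      rintro i q rfl hq
      exact hnest _ _ _ hq
    have := key _ (p v') h hle
    rwa [hp, hp] at this
  refine ⟨⟨fun v => (idx v).val, fun v => (p v).val, fun v => ZMod.val_lt _, ?_, ?_, ?_, ?_, ?_⟩⟩
  · intro v w hvw h
    have h : idx v = idx w := ZMod.val_injective k h
    have h1 : w ∈ closedNbhd R (u (idx v) (p v)) := by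
      apply hnest (idx v) (p v) ⟨m (idx v) - 1, by have := hm (idx v); omega⟩
      · have := (p v).isLt
        change (p v).val ≤ m (idx v) - 1
        omega
      · apply hlast
        rw [h]
        exact hidx w
    rw [hp] at h1
    rcases h1 with h1 | h1
    · exact absurd h1.symm hvw
    · exact h1
  · intro v w h
    have h0 : (p (u (idx v) ⟨0, hm _⟩)).val ≤ (p v).val := by
      rw [hpu]
      exact Nat.zero_le _
    have h1 : w ∈ closedNbhd R (u (idx v) ⟨0, hm _⟩) :=
      hnest' v _ (hu _ _) h0 (Or.inr h)
    rw [hfirst] at h1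
    rw [← ZMod.eq_add_one_iff_val, ← ZMod.eq_add_one_iff_val]
    rcases h1 with (h1 | h1) | h1
    · right; right
      rw [← hidx' _ _ h1]
      ring
    · left
      rw [← hidx' _ _ h1]
    · right; left
      rw [← hidx' _ _ h1]
  · intro v v' w h hle hne hadj
    have h : idx v' = idx v := ZMod.val_injective k h
    have h1 : w ∈ closedNbhd R v' := hnest' v v' h hle (Or.inr hadj)
    rcases h1 with h1 | h1
    · exact absurd h1.symm hne
    · exact h1
  · intro v w h h'
    have h : idx v = idx w := ZMod.val_injective k h
    have key : ∀ i (q : Fin (m i)), i = idx w → q.val = (p w).val →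
        u i q = u (idx w) (p w) := by
      rintro i q rfl hq
      rw [Fin.ext hq]
    have := key _ (p v) h h'
    rwa [hp, hp] at this
  · intro v j hj
    refine ⟨u (idx v) ⟨j, lt_of_le_of_lt hj (p v).isLt⟩, ?_, ?_⟩
    · simp only [hu]
    · simp only [hpu]

/-- Greedy colouring along a ranking `key`: every vertex receives the least (if `low` holds) or
the greatest (otherwise) colour not used by the vertices `w` with `B v w`. -/
lemma exists_greedy_coloring {V : Type} [Fintype V] (key : V → ℕ) (B : V → V → Prop)
    (hB : ∀ v w, B v w → key w < key v) (low : V → Prop) (r : ℕ)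
    (hr : ∀ v, {w | B v w}.ncard < r) :
    ∃ c : V → ℕ, (∀ v, c v < r) ∧ (∀ v w, B v w → c w ≠ c v) ∧
      (∀ v, low v → ∀ d < c v, ∃ w, B v w ∧ c w = d) ∧
      (∀ v, ¬ low v → ∀ d, c v < d → d < r → ∃ w, B v w ∧ c w = d) := by
  classical
  suffices h : ∀ n, ∃ c : V → ℕ, ∀ v, key v < n → c v < r ∧ (∀ w, B v w → c w ≠ c v) ∧
      (low v → ∀ d < c v, ∃ w, B v w ∧ c w = d) ∧
      (¬ low v → ∀ d, c v < d → d < r → ∃ w, B v w ∧ c w = d) by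
    obtain ⟨c, hc⟩ := h (Finset.univ.sup key + 1)
    have hc' := fun v => hc v (Nat.lt_succ_of_le (Finset.le_sup (Finset.mem_univ v)))
    exact ⟨c, fun v => (hc' v).1, fun v => (hc' v).2.1, fun v => (hc' v).2.2.1,
      fun v => (hc' v).2.2.2⟩
  intro n
  induction n with
  | zero => exact ⟨fun _ => 0, fun v hv => absurd hv (Nat.not_lt_zero _)⟩
  | succ n ih =>
    obtain ⟨c, hc⟩ := ih
    have hpick : ∀ v, ∃ x, x < r ∧ (∀ w, B v w → c w ≠ x) ∧
        (low v → ∀ d < x, ∃ w, B v w ∧ c w = d) ∧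
        (¬ low v → ∀ d, x < d → d < r → ∃ w, B v w ∧ c w = d) := by
      intro v
      set A := Finset.range r \ (Finset.univ.filter (B v)).image c with hA
      have hmem : ∀ d, d ∈ A ↔ d < r ∧ ∀ w, B v w → c w ≠ d := by
        intro d
        simp [hA]
      have hne : A.Nonempty := by
        rw [← Finset.card_pos]
        have h1 := Finset.le_card_sdiff ((Finset.univ.filter (B v)).image c) (Finset.range r)
        have h2 := Finset.card_image_le (s := Finset.univ.filter (B v)) (f := c)
        have h3 := hr v
        rw [Set.ncard_eq_toFinset_card', Set.toFinset_ofPred] at h3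
        rw [Finset.card_range, ← hA] at h1
        have h4 : (Finset.univ.filter (B v)).card < r := by convert h3
        omega
      by_cases hl : low v
      · refine ⟨A.min' hne, ((hmem _).1 (A.min'_mem hne)).1, ((hmem _).1 (A.min'_mem hne)).2,
          fun _ d hd => ?_, fun h => absurd hl h⟩
        by_contra hcon
        push Not at hcon
        exact absurd (A.min'_le d ((hmem d).2
          ⟨hd.trans ((hmem _).1 (A.min'_mem hne)).1, hcon⟩)) (not_le.2 hd)
      · refine ⟨A.max' hne, ((hmem _).1 (A.max'_mem hne)).1, ((hmem _).1 (A.max'_mem hne)).2,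
          fun h => absurd h hl, fun _ d hd hdr => ?_⟩
        by_contra hcon
        push Not at hcon
        exact absurd (A.le_max' d ((hmem d).2 ⟨hdr, hcon⟩)) (not_le.2 hd)
    choose x hx using hpick
    refine ⟨fun v => if key v < n then c v else x v, fun v hv => ?_⟩
    have hw : ∀ w, B v w → (if key w < n then c w else x w) = c w := fun w hw => by
      have := hB v w hw
      rw [if_pos (by omega)]
    have hex : ∀ d, (∃ w, B v w ∧ c w = d) →
        ∃ w, B v w ∧ (if key w < n then c w else x w) = d := by
      rintro d ⟨w, hBw, rfl⟩
      exact ⟨w, hBw, hw w hBw⟩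
    by_cases hn : key v < n
    · obtain ⟨h1, h2, h3, h4⟩ := hc v hn
      simp only [if_pos hn]
      exact ⟨h1, fun w hBw => by rw [hw w hBw]; exact h2 w hBw, fun hl d hd => hex d (h3 hl d hd),
        fun hl d hd hdr => hex d (h4 hl d hd hdr)⟩
    · obtain ⟨h1, h2, h3, h4⟩ := hx v
      simp only [if_neg hn]
      exact ⟨h1, fun w hBw => by rw [hw w hBw]; exact h2 w hBw, fun hl d hd => hex d (h3 hl d hd),
        fun hl d hd hdr => hex d (h4 hl d hd hdr)⟩

namespace RingLayout

variable {V : Type} {R : SimpleGraph V} {k : ℕ} (L : RingLayout R k)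

/-- The vertices of the layer of `v` that come no later than `v`. -/
def initialSeg (v : V) : Set V := {w | L.lay w = L.lay v ∧ L.pos w ≤ L.pos v}

lemma mem_initialSeg_self (v : V) : v ∈ L.initialSeg v := ⟨rfl, le_rfl⟩

lemma adj_of_mem_initialSeg {v w v' w' : V} (h : R.Adj v w) (hlay : L.lay v ≠ L.lay w)
    (hv : v' ∈ L.initialSeg v) (hw : w' ∈ L.initialSeg w) : R.Adj v' w' := by
  have h1 : R.Adj v' w := L.adj_of_le v v' w hv.1 hv.2
    (fun e => hlay (by rw [← hv.1, e])) h
  exact (L.adj_of_le w w' v' hw.1 hw.2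
    (fun e => hlay (by rw [← hv.1, ← hw.1, e])) h1.symm).symm

lemma isClique_initialSeg_union {v w : V} (h : R.Adj v w) (hlay : L.lay v ≠ L.lay w) :
    R.IsClique (L.initialSeg v ∪ L.initialSeg w) := by
  rintro x (hx | hx) y (hy | hy) hxy
  · exact L.adj_of_lay_eq _ _ hxy (hx.1.trans hy.1.symm)
  · exact L.adj_of_mem_initialSeg h hlay hx hy
  · exact (L.adj_of_mem_initialSeg h hlay hy hx).symm
  · exact L.adj_of_lay_eq _ _ hxy (hx.1.trans hy.1.symm)

lemma ncard_initialSeg [Finite V] (v : V) : (L.initialSeg v).ncard = L.pos v + 1 := by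
  have h : L.pos '' L.initialSeg v = Set.Iic (L.pos v) := by
    ext j
    constructor
    · rintro ⟨w, hw, rfl⟩
      exact hw.2
    · intro hj
      obtain ⟨w, hw, rfl⟩ := L.exists_pos v j hj
      exact ⟨w, ⟨hw, hj⟩, rfl⟩
  rw [← Set.InjOn.ncard_image (f := L.pos), h]
  · rw [Set.ncard_eq_toFinset_card']
    simp
  · intro x hx y hy hxy
    exact L.pos_inj x y (hx.1.trans hy.1.symm) hxy

lemma pos_lt_of_clique_bound [Finite V] {r : ℕ} (hω : ∀ s : Set V, R.IsClique s → s.ncard ≤ r)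
    (v : V) : L.pos v < r := by
  have h := hω (L.initialSeg v) fun x hx y hy hxy =>
    L.adj_of_lay_eq _ _ hxy (hx.1.trans hy.1.symm)
  rw [L.ncard_initialSeg] at h
  omega

lemma pos_add_pos_lt_of_clique_bound [Finite V] {r : ℕ}
    (hω : ∀ s : Set V, R.IsClique s → s.ncard ≤ r)
    {v w : V} (h : R.Adj v w) (hlay : L.lay v ≠ L.lay w) : L.pos v + L.pos w + 1 < r := by
  have h1 := hω _ (L.isClique_initialSeg_union h hlay)
  rw [Set.ncard_union_eq, L.ncard_initialSeg, L.ncard_initialSeg] at h1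
  · omega
  · rw [Set.disjoint_left]
    intro x hx hy
    exact hlay (hx.1.symm.trans hy.1)

lemma colorable_of_even [Finite V] (L : RingLayout R k) {r : ℕ} (hk : Even k)
    (hω : ∀ s : Set V, R.IsClique s → s.ncard ≤ r) : R.Colorable r := by
  refine ⟨SimpleGraph.Coloring.mk (fun v => if L.lay v % 2 = 0 then
      (⟨L.pos v, L.pos_lt_of_clique_bound hω v⟩ : Fin r) else
      ⟨r - 1 - L.pos v, by have := L.pos_lt_of_clique_bound hω v; omega⟩) ?_⟩
  intro v w hvw
  have hv := L.pos_lt_of_clique_bound hω v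
  have hw := L.pos_lt_of_clique_bound hω w
  have hpar : ∀ i j, i < k → (i + 1) % k = j → i % 2 ≠ j % 2 := by
    intro i j hi hij
    rw [← hij, Nat.mod_mod_of_dvd _ hk.two_dvd]
    omega
  by_cases hl : L.lay v = L.lay w
  · have hp : L.pos v ≠ L.pos w := fun hp => hvw.ne (L.pos_inj _ _ hl hp)
    rw [hl]
    split_ifs <;> simp only [ne_eq, Fin.mk.injEq] <;> omega
  · have hs := L.pos_add_pos_lt_of_clique_bound hω hvw hl
    have hne : L.lay v % 2 ≠ L.lay w % 2 := by
      rcases L.lay_of_adj _ _ hvw with h | h | h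
      · exact absurd h.symm hl
      · exact hpar _ _ (L.lay_lt v) h
      · exact (hpar _ _ (L.lay_lt w) h).symm
    split_ifs <;> simp only [ne_eq, Fin.mk.injEq] <;> omega

/-- The vertex `w` is coloured before `v`, and restricts the choice of the colour of `v`. -/
def Blocks (v w : V) : Prop :=
  R.Adj v w ∧ (L.lay w = L.lay v ∧ L.pos w < L.pos v ∨ L.lay v = L.lay w + 1)

lemma isClique_insert_blocks (v : V) : R.IsClique (insert v {w | L.Blocks v w}) := by
  have hcross : ∀ x y, L.Blocks v x → L.Blocks v y → L.lay x = L.lay v → L.pos x < L.pos v →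
      L.lay v = L.lay y + 1 → R.Adj x y := fun x y _ hy h1 h2 h3 =>
    L.adj_of_le v x y h1 h2.le (fun e => by rw [e] at h1; omega) hy.1
  apply SimpleGraph.IsClique.insert
  · intro x hx y hy hxy
    rcases hx.2 with ⟨h1, h2⟩ | h1 <;> rcases hy.2 with ⟨h3, h4⟩ | h3
    · exact L.adj_of_lay_eq _ _ hxy (h1.trans h3.symm)
    · exact hcross x y hx hy h1 h2 h3
    · exact (hcross y x hy hx h3 h4 h1).symm
    · exact L.adj_of_lay_eq _ _ hxy (by omega)
  · intro w hw _
    exact hw.1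

lemma exists_ringGreedy [Fintype V] {r : ℕ} (hω : ∀ s : Set V, R.IsClique s → s.ncard ≤ r) :
    ∃ c : V → ℕ, (∀ v, c v < r) ∧ (∀ v w, L.Blocks v w → c w ≠ c v) ∧
      (∀ v, L.lay v = 0 ∨ L.lay v % 2 = 1 → ∀ d < c v, ∃ w, L.Blocks v w ∧ c w = d) ∧
      (∀ v, ¬ (L.lay v = 0 ∨ L.lay v % 2 = 1) → ∀ d, c v < d → d < r →
        ∃ w, L.Blocks v w ∧ c w = d) := by
  refine exists_greedy_coloring (fun v => L.lay v * r + L.pos v) L.Blocks ?_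
    (fun v => L.lay v = 0 ∨ L.lay v % 2 = 1) r ?_
  · rintro v w ⟨-, ⟨h, h'⟩ | h⟩
    · simp only [h]
      omega
    · have := L.pos_lt_of_clique_bound hω w
      simp only [h]
      rw [add_mul]
      omega
  · intro v
    have h := hω _ (L.isClique_insert_blocks v)
    have hv : v ∉ {w | L.Blocks v w} := fun h => R.loopless.irrefl v h.1
    rw [Set.ncard_insert_of_notMem hv] at h
    omega

/-- A selection of one vertex in each layer, consecutive ones being adjacent, spans an induced
hyperhole consisting of the initial segments of the selected vertices. -/
lemma isHyperhole_induce (hk : 4 ≤ k) (Z : ℕ → V) (hZ : ∀ i < k, L.lay (Z i) = i)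
    (hadj : ∀ i < k, R.Adj (Z i) (Z ((i + 1) % k))) :
    IsHyperhole (R.induce {v | v ∈ L.initialSeg (Z (L.lay v))}) k := by
  have : NeZero k := ⟨by omega⟩
  set S := {v | v ∈ L.initialSeg (Z (L.lay v))} with hS
  have hval : ∀ (i : ZMod k) (v : V), i = (L.lay v : ZMod k) ↔ i.val = L.lay v := by
    intro i v
    rw [← (ZMod.val_injective k).eq_iff, ZMod.val_cast_of_lt (L.lay_lt v)]
  have hnext : ∀ v w : V, (L.lay w : ZMod k) = L.lay v + 1 ↔ (L.lay v + 1) % k = L.lay w := by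
    intro v w
    rw [ZMod.eq_add_one_iff_val, ZMod.val_cast_of_lt (L.lay_lt v),
      ZMod.val_cast_of_lt (L.lay_lt w)]
  have hcomplete : ∀ v ∈ S, ∀ w ∈ S, (L.lay v + 1) % k = L.lay w → R.Adj v w := by
    intro v hv w hw h
    have h1 := hadj _ (L.lay_lt v)
    rw [h] at h1
    refine L.adj_of_mem_initialSeg h1 ?_ hv hw
    rw [hZ _ (L.lay_lt v), hZ _ (L.lay_lt w), ← h]
    have := L.lay_lt v
    rcases Nat.lt_or_ge (L.lay v + 1) k with h2 | h2
    · rw [Nat.mod_eq_of_lt h2]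
      omega
    · rw [show L.lay v + 1 = k by omega, Nat.mod_self]
      omega
  refine ⟨fun i => {v | i = (L.lay v.1 : ZMod k)}, ?_, ?_, ?_, ?_, ?_⟩
  · intro i
    have h := hZ i.val (ZMod.val_lt i)
    refine ⟨⟨Z i.val, ?_⟩, ?_⟩
    · change Z i.val ∈ L.initialSeg _
      rw [h]
      exact L.mem_initialSeg_self _
    · exact (hval _ _).2 h.symm
  · intro v
    exact ⟨_, rfl, fun i hi => hi⟩
  · intro i x hx y hy hxy
    have hx : i = _ := hx
    have hy : i = _ := hy
    rw [hval] at hx hy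
    exact L.adj_of_lay_eq _ _ (fun h => hxy (Subtype.ext h)) (hx.symm.trans hy)
  · rintro i x hx y (hy | hy)
    · have hx : i = _ := hx
      have hy : i - 1 = _ := hy
      refine (hcomplete y y.2 x x.2 ((hnext _ _).1 ?_)).symm
      rw [← hx, ← hy]
      ring
    · have hx : i = _ := hx
      have hy : i + 1 = _ := hy
      refine hcomplete x x.2 y y.2 ((hnext _ _).1 ?_)
      rw [← hx, ← hy]
  · intro i x hx y hy hxy
    have hx : i = _ := hx
    have hxy : R.Adj x.1 y.1 := hxy
    apply hy
    rcases L.lay_of_adj _ _ hxy with h | h | h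
    · left; right
      change i = _
      rw [hx, h]
    · right
      change i + 1 = _
      rw [hx, (hnext _ _).2 h]
    · left; left
      change i - 1 = _
      rw [hx, (hnext _ _).2 h]
      ring

/-- If the initial segments of `Z 0, …, Z (2 * m)` are such that any two consecutive ones contain
alternately all colours `≤ a` and all colours in `(a, r)`, and the last layer contains the
additional colour `a`, then they have more than `m * r` vertices in total. -/
lemma lt_ncard_of_covers [Finite V] {r m a : ℕ} (c : V → ℕ) (Z : ℕ → V)
    (hZ : ∀ i < 2 * m + 1, L.lay (Z i) = i) (ha : c (Z (2 * m)) = a)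
    (hodd : ∀ t < m, ∀ d ≤ a,
      ∃ w, (w ∈ L.initialSeg (Z (2 * t + 1)) ∨ w ∈ L.initialSeg (Z (2 * t))) ∧ c w = d)
    (heven : ∀ t < m, ∀ d, a < d → d < r →
      ∃ w, (w ∈ L.initialSeg (Z (2 * t + 2)) ∨ w ∈ L.initialSeg (Z (2 * t + 1))) ∧ c w = d) :
    m * r < {v | v ∈ L.initialSeg (Z (L.lay v))}.ncard := by
  set S := {v | v ∈ L.initialSeg (Z (L.lay v))} with hS
  have hmem : ∀ i < 2 * m + 1, ∀ w ∈ L.initialSeg (Z i), w ∈ S ∧ L.lay w = i := by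
    intro i hi w hw
    have h : L.lay w = i := hw.1.trans (hZ i hi)
    refine ⟨?_, h⟩
    change w ∈ L.initialSeg _
    rwa [h]
  have hex : ∀ q : Fin m × Fin r, ∃ w ∈ S, c w = q.2.val ∧
      (q.2.val ≤ a → L.lay w / 2 = q.1.val) ∧ (a < q.2.val → (L.lay w - 1) / 2 = q.1.val) ∧
      w ≠ Z (2 * m) := by
    rintro ⟨⟨t, ht⟩, ⟨d, hd⟩⟩
    rcases le_or_gt d a with h | h
    · obtain ⟨w, hw | hw, hcw⟩ := hodd t ht d h <;>
        obtain ⟨h1, h2⟩ := hmem _ (by omega) w hw <;>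
        refine ⟨w, h1, hcw, fun _ => ?_, fun h' => absurd h' (not_lt.2 h), fun e => ?_⟩
      · simp only; omega
      · rw [e, hZ _ (by omega)] at h2
        omega
      · simp only; omega
      · rw [e, hZ _ (by omega)] at h2
        omega
    · obtain ⟨w, hw | hw, hcw⟩ := heven t ht d h hd <;>
        obtain ⟨h1, h2⟩ := hmem _ (by omega) w hw <;>
        refine ⟨w, h1, hcw, fun h' => absurd h' (not_le.2 h), fun _ => ?_, fun e => ?_⟩
      · simp only; omega
      · rw [e, ha] at hcw
        omega
      · simp only; omega
      · rw [e, ha] at hcw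
        omega
  choose g hgS hgc hglow hghigh hgne using hex
  have hinj : Function.Injective g := by
    intro q q' h
    have h2 : q.2.val = q'.2.val := by rw [← hgc, ← hgc, h]
    have h1 : q.1.val = q'.1.val := by
      rcases le_or_gt q.2.val a with h3 | h3
      · rw [← hglow q h3, ← hglow q' (h2 ▸ h3), h]
      · rw [← hghigh q h3, ← hghigh q' (h2 ▸ h3), h]
    exact Prod.ext (Fin.ext h1) (Fin.ext h2)
  have hlast : Z (2 * m) ∈ S := (hmem _ (by omega) _ (L.mem_initialSeg_self _)).1
  have hss : Set.range g ⊂ S := by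
    refine ⟨?_, fun h => ?_⟩
    · rintro _ ⟨q, rfl⟩
      exact hgS q
    · obtain ⟨q, hq⟩ := h hlast
      exact hgne q hq
  have := Set.ncard_lt_ncard hss
  rwa [← Set.image_univ, Set.ncard_image_of_injective _ hinj, Set.ncard_univ, Nat.card_prod,
    Nat.card_fin, Nat.card_fin] at this

/-- Starting from a vertex `z` in layer `j` whose colour is undesirable for that layer, one can
descend through the layers along adjacent vertices with undesirable colours, in such a way that
the initial segments of any two consecutive vertices contain all desirable colours. -/
lemma exists_descent [Finite V] {r a : ℕ} (c : V → ℕ)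
    (hproper : ∀ v w, L.Blocks v w → c w ≠ c v)
    (hlt : ∀ v, c v < r)
    (hlow : ∀ v, L.lay v = 0 ∨ L.lay v % 2 = 1 → ∀ d < c v, ∃ w, L.Blocks v w ∧ c w = d)
    (hhigh : ∀ v, ¬ (L.lay v = 0 ∨ L.lay v % 2 = 1) → ∀ d, c v < d → d < r →
      ∃ w, L.Blocks v w ∧ c w = d)
    (j : ℕ) (z : V) (hz : L.lay z = j) (hcz : a < c z ↔ j % 2 = 1)
    (hz' : j ≠ 0 → ∃ w, R.Adj z w ∧ j = L.lay w + 1 ∧ (a < c w ↔ L.lay w % 2 = 1)) :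
    ∃ Z : ℕ → V, Z j = z ∧ (∀ i ≤ j, L.lay (Z i) = i ∧ (a < c (Z i) ↔ i % 2 = 1)) ∧
      ∀ i < j, R.Adj (Z (i + 1)) (Z i) ∧ ∀ d < r, (a < d ↔ i % 2 = 1) →
        ∃ w, (w ∈ L.initialSeg (Z (i + 1)) ∨ w ∈ L.initialSeg (Z i)) ∧ c w = d := by
  induction j generalizing z with
  | zero =>
    refine ⟨fun _ => z, rfl, fun i hi => ?_, fun i hi => absurd hi (Nat.not_lt_zero _)⟩
    obtain rfl : i = 0 := by omega
    exact ⟨hz, hcz⟩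
  | succ j ih =>
    have hblock : ∀ v d, L.lay v ≠ 0 → (a < c v ↔ L.lay v % 2 = 1) → d < r →
        (a < d ↔ L.lay v % 2 ≠ 1) → ∃ w, L.Blocks v w ∧ c w = d := by
      intro v d h0 h1 h2 h3
      by_cases h : L.lay v % 2 = 1
      · exact hlow v (Or.inr h) d (by have := h1.2 h; have := mt h3.1 (not_not.2 h); omega)
      · exact hhigh v (by tauto) d (by have := h3.2 h; have := mt h1.1 h; omega) h2
    obtain ⟨z', ⟨hadj, hlay, hc⟩, hmax⟩ := Set.exists_max_image
      {w | R.Adj z w ∧ j + 1 = L.lay w + 1 ∧ (a < c w ↔ L.lay w % 2 = 1)} L.pos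
      (Set.toFinite _) (hz' (Nat.succ_ne_zero j))
    obtain hlay : L.lay z' = j := by omega
    obtain ⟨Z, hZj, hZ, hcov⟩ := ih z' hlay (by rwa [hlay] at hc) (by
      intro hj
      obtain ⟨w, hw, hcw⟩ := hblock z' (c z) (by omega) hc (hlt z) (by
        rw [hcz, hlay]
        omega)
      rcases hw.2 with ⟨h1, h2⟩ | h1
      · refine absurd hcw (hproper z w ⟨?_, Or.inr (by omega)⟩)
        exact (L.adj_of_le z' w z h1 h2.le (fun e => by rw [e] at h1; omega) hadj.symm).symm
      · refine ⟨w, hw.1, by omega, ?_⟩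
        rw [hcw, hcz]
        omega)
    have hne : ∀ i, i ≤ j → i ≠ j + 1 := fun i hi => by omega
    refine ⟨fun i => if i = j + 1 then z else Z i, if_pos rfl, fun i hi => ?_, fun i hi => ?_⟩ <;> beta_reduce
    · rcases Nat.lt_or_ge j i with h | h
      · obtain rfl : i = j + 1 := by omega
        rw [if_pos rfl]
        exact ⟨hz, hcz⟩
      · rw [if_neg (hne i h)]
        exact hZ i h
    · rw [if_neg (hne i (by omega))]
      by_cases hij : i = j
      · subst hij
        rw [if_pos rfl, hZj]
        refine ⟨hadj, fun d hd had => ?_⟩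
        obtain ⟨w, hw, hcw⟩ := hblock z d (by omega) (by rwa [hz]) hd (by
          rw [had, hz]
          omega)
        refine ⟨w, ?_, hcw⟩
        rcases hw.2 with ⟨h1, h2⟩ | h1
        · exact Or.inl ⟨h1, h2.le⟩
        · have hwi : L.lay w = i := by omega
          refine Or.inr ⟨hwi.trans hlay.symm, hmax w ⟨hw.1, by omega, ?_⟩⟩
          rw [hcw, hwi]
          exact had
      · rw [if_neg (by omega)]
        exact hcov i (by omega)

lemma colorable_of_odd [Fintype V] (L : RingLayout R k) {r m : ℕ} (hm : 2 ≤ m) (hk : k = 2 * m + 1)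
    (hω : ∀ s : Set V, R.IsClique s → s.ncard ≤ r)
    (hH : ∀ S : Set V, IsHyperhole (R.induce S) k → S.ncard ≤ m * r) : R.Colorable r := by
  obtain ⟨c, hlt, hproper, hlow, hhigh⟩ := L.exists_ringGreedy hω
  suffices hclose : ∀ x y, R.Adj y x → L.lay x = 0 → L.lay y = 2 * m → c y ≠ c x by
    have hnext : ∀ v w, R.Adj v w → (L.lay v + 1) % k = L.lay w → c v ≠ c w := by
      intro v w hvw h
      have := L.lay_lt v
      rcases Nat.lt_or_ge (L.lay v + 1) k with h2 | h2
      · rw [Nat.mod_eq_of_lt h2] at h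
        exact hproper w v ⟨hvw.symm, Or.inr h.symm⟩
      · have h3 : L.lay v + 1 = k := by omega
        rw [h3, Nat.mod_self] at h
        exact hclose w v hvw h.symm (by omega)
    refine ⟨SimpleGraph.Coloring.mk (fun v => (⟨c v, hlt v⟩ : Fin r)) ?_⟩
    intro v w hvw h
    have h : c v = c w := congrArg Fin.val h
    rcases L.lay_of_adj _ _ hvw with h1 | h1 | h1
    · rcases lt_trichotomy (L.pos v) (L.pos w) with h2 | h2 | h2
      · exact hproper w v ⟨hvw.symm, Or.inl ⟨h1.symm, h2⟩⟩ h
      · exact hvw.ne (L.pos_inj _ _ h1.symm h2)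
      · exact hproper v w ⟨hvw, Or.inl ⟨h1, h2⟩⟩ h.symm
    · exact hnext _ _ hvw h1 h
    · exact hnext _ _ hvw.symm h1 h.symm
  intro x y hxy hx hy hc
  have hfirst : ∀ d ≤ c x, ∃ w ∈ L.initialSeg x, c w = d := by
    intro d hd
    rcases hd.eq_or_lt with rfl | hd
    · exact ⟨x, L.mem_initialSeg_self x, rfl⟩
    · obtain ⟨w, hw, hcw⟩ := hlow x (Or.inl hx) d hd
      rcases hw.2 with ⟨h1, h2⟩ | h1
      · exact ⟨w, ⟨h1, h2.le⟩, hcw⟩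
      · omega
  have hstart : ∃ w, R.Adj y w ∧ 2 * m = L.lay w + 1 ∧ (c x < c w ↔ L.lay w % 2 = 1) := by
    by_contra hcon
    push Not at hcon
    have hcover : Set.Iio r ⊆ c '' ((L.initialSeg y ∪ L.initialSeg x) \ {y}) := by
      intro d hd
      have hd : d < r := hd
      rcases le_or_gt d (c x) with h | h
      · obtain ⟨w, hw, hcw⟩ := hfirst d h
        refine ⟨w, ⟨Or.inr hw, fun e => ?_⟩, hcw⟩
        rw [Set.mem_singleton_iff.1 e] at hw
        have := hw.1
        omega
      · obtain ⟨w, hw, hcw⟩ := hhigh y (by omega) d (by omega) hd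
        rcases hw.2 with ⟨h1, h2⟩ | h1
        · refine ⟨w, ⟨Or.inl ⟨h1, h2.le⟩, fun e => ?_⟩, hcw⟩
          rw [Set.mem_singleton_iff.1 e] at h2
          omega
        · rcases hcon w hw.1 (by omega) with h3 | h3 <;> omega
    have h1 := Set.ncard_le_ncard hcover
    have h2 := Set.ncard_image_le (f := c) ((L.initialSeg y ∪ L.initialSeg x) \ {y}).toFinite
    have h3 := Set.ncard_sdiff_singleton_add_one
      (Set.mem_union_left (L.initialSeg x) (L.mem_initialSeg_self y))
    have h4 := hω _ (L.isClique_initialSeg_union hxy (by omega))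
    have h5 : (Set.Iio r).ncard = r := by
      rw [Set.ncard_eq_toFinset_card']
      simp
    omega
  obtain ⟨Z, hZy, hZ, hcov⟩ := L.exists_descent c hproper hlt hlow hhigh (2 * m) y hy
    (by rw [hc]; omega) (fun _ => hstart)
  have hZ0 : Z 0 ∈ L.initialSeg x := by
    obtain ⟨h1, h2⟩ := hZ 0 (Nat.zero_le _)
    obtain ⟨w, hw, hcw⟩ := hfirst (c (Z 0)) (by omega)
    have hlay : L.lay w = L.lay (Z 0) := by rw [hw.1, hx, h1]
    rcases lt_trichotomy (L.pos w) (L.pos (Z 0)) with h3 | h3 | h3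
    · exact absurd hcw (hproper (Z 0) w
        ⟨L.adj_of_lay_eq _ _ (fun e => by rw [e] at h3; omega) hlay.symm, Or.inl ⟨hlay, h3⟩⟩)
    · rwa [← L.pos_inj _ _ hlay h3]
    · exact ⟨h1.trans hx.symm, h3.le.trans hw.2⟩
  have hhole := L.isHyperhole_induce (by omega) Z (fun i hi => (hZ i (by omega)).1) (by
    intro i hi
    rcases Nat.lt_or_ge (i + 1) k with h2 | h2
    · rw [Nat.mod_eq_of_lt h2]
      exact (hcov i (by omega)).1.symm
    · rw [show i + 1 = k by omega, Nat.mod_self, show i = 2 * m by omega, hZy]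
      exact L.adj_of_mem_initialSeg hxy (by omega) (L.mem_initialSeg_self y) hZ0)
  have hcard := L.lt_ncard_of_covers (r := r) (m := m) (a := c x) c Z
    (fun i hi => (hZ i (by omega)).1) (by rw [hZy, hc])
    (fun t ht d hd => (hcov (2 * t) (by omega)).2 d (lt_of_le_of_lt hd (hlt x)) (by omega))
    (fun t ht d hd hdr => (hcov (2 * t + 1) (by omega)).2 d hdr (by omega))
  exact absurd (hH _ hhole) (not_le.2 hcard)

end RingLayout

/-- A stable set in a `k`-hyperhole has at most `⌊k / 2⌋` vertices, whence a lower bound on the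
number of colours. -/
lemma IsHyperhole.card_le_mul {W : Type} [Finite W] {H : SimpleGraph W} {k n : ℕ} (hk : k ≠ 0)
    (hH : IsHyperhole H k) (hn : H.Colorable n) : Nat.card W ≤ k / 2 * n := by
  classical
  have : NeZero k := ⟨hk⟩
  have := Fintype.ofFinite W
  obtain ⟨X, -, hpart, hclique, hcompl, -⟩ := hH
  choose idx hidx hidx' using hpart
  obtain ⟨C⟩ := hn
  rw [Nat.card_eq_fintype_card, ← Finset.card_univ]
  have hclass : ∀ d : Fin n, (Finset.univ.filter fun v => C v = d).card ≤ k / 2 := by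
    intro d
    set A := Finset.univ.filter fun v => C v = d with hA
    have hind : ∀ v ∈ A, ∀ w ∈ A, ¬ H.Adj v w := by
      intro v hv w hw h
      rw [hA, Finset.mem_filter] at hv hw
      exact C.valid h (hv.2.trans hw.2.symm)
    have hinj : Set.InjOn idx A := by
      intro v hv w hw h
      by_contra hne
      exact hind v hv w hw (hclique (idx v) (hidx v) (h ▸ hidx w) hne)
    have hdisj : Disjoint (A.image idx) ((A.image idx).image (· + 1)) := by
      rw [Finset.disjoint_left]
      intro i hi hi'
      simp only [Finset.mem_image] at hi hi'
      obtain ⟨v, hv, rfl⟩ := hi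
      obtain ⟨_, ⟨w, hw, rfl⟩, h⟩ := hi'
      refine hind w hw v hv (hcompl (idx w) w (hidx w) v (Or.inr ?_))
      rw [h]
      exact hidx v
    have h1 := Finset.card_le_univ (A.image idx ∪ (A.image idx).image (· + 1))
    rw [Finset.card_union_of_disjoint hdisj, ZMod.card,
      Finset.card_image_of_injective _ (add_left_injective 1), Finset.card_image_of_injOn hinj]
      at h1
    omega
  have h := Finset.card_le_mul_card_image_of_maps_to (f := C) (s := Finset.univ)
    (t := Finset.univ) (fun _ _ => Finset.mem_univ _) (k / 2) (fun d _ => hclass d)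
  simpa using h

/-- For a `k`-ring `R`, `χ(R)` equals the maximum of `ω(R)` together with the
values `⌈|V(H)| / ⌊k/2⌋⌉` over all `k`-hyperholes `H` induced in `R`. -/
theorem ring_chromaticNumber_formula {V : Type} [Fintype V]
    (k : ℕ) (hk : 4 ≤ k) (R : SimpleGraph V) (hR : IsRing R k) :
    R.chromaticNumber =
      sSup ({(R.cliqueNum : ℕ∞)} ∪
        {x : ℕ∞ | ∃ S : Set V, IsHyperhole (R.induce S) k ∧
          x = (((S.ncard + k / 2 - 1) / (k / 2) : ℕ) : ℕ∞)}) := by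
  have hm : 0 < k / 2 := by omega
  apply le_antisymm
  · by_contra hlt
    push Not at hlt
    obtain ⟨r, hr⟩ := ENat.ne_top_iff_exists.1 (ne_top_of_lt hlt)
    rw [← hr] at hlt
    have hmem := fun x hx => hr.symm ▸ le_sSup (a := x) (s := {(R.cliqueNum : ℕ∞)} ∪
        {x : ℕ∞ | ∃ S : Set V, IsHyperhole (R.induce S) k ∧
          x = (((S.ncard + k / 2 - 1) / (k / 2) : ℕ) : ℕ∞)}) hx
    have hω : ∀ s : Set V, R.IsClique s → s.ncard ≤ r := by
      classical
      intro s hs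
      have h1 : R.cliqueNum ≤ r := by exact_mod_cast hmem _ (Or.inl rfl)
      rw [Set.ncard_eq_toFinset_card']
      refine le_trans (SimpleGraph.IsClique.card_le_cliqueNum (tc := ?_)) h1
      simpa using hs
    have hH : ∀ S : Set V, IsHyperhole (R.induce S) k → S.ncard ≤ k / 2 * r := by
      intro S hS
      have h1 : (S.ncard + k / 2 - 1) / (k / 2) ≤ r := by
        exact_mod_cast hmem _ (Or.inr ⟨S, hS, rfl⟩)
      have h2 := (Nat.div_lt_iff_lt_mul hm).1 (Nat.lt_succ_of_le h1)
      rw [Nat.succ_mul, mul_comm] at h2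
      omega
    obtain ⟨L⟩ := hR.nonempty_layout (by omega)
    have hcol : R.Colorable r := by
      rcases Nat.even_or_odd' k with ⟨m, h | h⟩
      · exact L.colorable_of_even ⟨m, by omega⟩ hω
      · rw [show k / 2 = m by omega] at hH
        exact L.colorable_of_odd (by omega) h hω hH
    exact absurd hcol.chromaticNumber_le (not_le.2 hlt)
  · apply sSup_le
    rintro _ (rfl | ⟨S, hS, rfl⟩)
    · obtain ⟨s, hs⟩ := R.exists_isNClique_cliqueNum
      rw [← hs.card_eq]
      exact hs.isClique.card_le_chromaticNumber
    · rw [SimpleGraph.le_chromaticNumber_iff_colorable]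
      intro n hn
      have h := hS.card_le_mul (by omega) (hn.of_hom (SimpleGraph.Embedding.induce S).toHom)
      rw [Nat.card_coe_set_eq] at h
      rw [← Nat.lt_succ_iff, Nat.div_lt_iff_lt_mul hm, Nat.succ_mul, mul_comm]
      omega
end

section
/- Let k ≥ 5 be an odd integer. Then every k-hyperantihole A satisfies ω(A) ≥ (k−1)/2 and χ(A) ≤ g_k(ω(A)). -/
open SimpleGraph

/-- The sequence started at `t` in which each term is the part of the demand `w i` that is
not met by the preceding term. -/
def residualSeq (w : ℕ → ℕ) (t : ℕ) : ℕ → ℕ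
  | 0 => t
  | i + 1 => w i - residualSeq w t i

lemma residualSeq_mono (w : ℕ → ℕ) {s t : ℕ} (hst : s ≤ t) (i : ℕ) :
    (Even i → residualSeq w s i ≤ residualSeq w t i) ∧
    (Odd i → residualSeq w t i ≤ residualSeq w s i) := by
  induction i with
  | zero => exact ⟨fun _ => hst, fun h => by simp at h⟩
  | succ i ih =>
    simp only [residualSeq]
    constructor
    · intro h
      have := ih.2 (by grind)
      omega
    · intro h
      have := ih.1 (by grind)
      omega

lemma residualSeq_succ_start (w : ℕ → ℕ) (t i : ℕ) :
    residualSeq w t i ≤ residualSeq w (t + 1) i + 1 ∧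
    residualSeq w (t + 1) i ≤ residualSeq w t i + 1 ∧
    (residualSeq w t i ≠ residualSeq w (t + 1) i →
      ∀ j < i, residualSeq w (t + 1) j + residualSeq w (t + 1) (j + 1) = w j) := by
  induction i with
  | zero => simp [residualSeq]; omega
  | succ i ih =>
    obtain ⟨h1, h2, h3⟩ := ih
    refine ⟨by simp only [residualSeq]; omega, by simp only [residualSeq]; omega, ?_⟩
    intro hne j hj
    simp only [residualSeq] at hne ⊢
    rcases Nat.lt_succ_iff_lt_or_eq.mp hj with hj | rfl
    · exact h3 (by omega) j hj
    · omega

lemma residualSeq_fixed_or_swap (w : ℕ → ℕ) {k : ℕ} (hk : Odd k) :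
    (∃ t, residualSeq w t k = t) ∨
    ∃ t, residualSeq w t k = t + 1 ∧ residualSeq w (t + 1) k = t := by
  classical
  have hex : ∃ t, residualSeq w t k ≤ t :=
    ⟨residualSeq w 0 k, (residualSeq_mono w (Nat.zero_le _) k).2 hk⟩
  have hspec := Nat.find_spec hex
  have hmin := fun s => @Nat.find_min _ _ hex s
  generalize Nat.find hex = t at hspec hmin
  rcases t with _ | t
  · exact Or.inl ⟨0, by omega⟩
  · have h1 := hmin t (by omega)
    have h2 := residualSeq_succ_start w t k
    by_cases h : residualSeq w (t + 1) k = t + 1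
    · exact Or.inl ⟨_, h⟩
    · exact Or.inr ⟨t, by omega, by omega⟩

/-- On a path, the total of the residual sequence started at `0` is the weight of a stable set. -/
lemma exists_stable_sum_eq (w y : ℕ → ℕ) (h0 : y 0 = 0)
    (hy : ∀ i, y (i + 1) = w (i + 1) - y i) (l : ℕ) :
    ∃ S ⊆ Finset.Icc 1 l, (∀ i ∈ S, i + 1 ∉ S) ∧
      ∑ i ∈ Finset.range (l + 1), y i = ∑ i ∈ S, w i := by
  induction l using Nat.strong_induction_on with
  | _ l ih =>
    rcases l with _ | l
    · exact ⟨∅, by simp, by simp, by simp [h0]⟩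
    by_cases hz : y (l + 1) = 0
    · obtain ⟨S, hS, hst, hsum⟩ := ih l (by omega)
      refine ⟨S, hS.trans (Finset.Icc_subset_Icc_right (by omega)), hst, ?_⟩
      rw [Finset.sum_range_succ, hz, hsum, add_zero]
    · rcases l with _ | l
      · refine ⟨{1}, by simp, by simp, ?_⟩
        simp [Finset.sum_range_succ, h0, hy]
      · obtain ⟨S, hS, hst, hsum⟩ := ih l (by omega)
        have hb : ∀ i ∈ S, i ≤ l := fun i hi => (Finset.mem_Icc.mp (hS hi)).2
        have hnot : l + 2 ∉ S := fun h => by have := hb _ h; omega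
        refine ⟨insert (l + 2) S, ?_, ?_, ?_⟩
        · intro i hi
          rcases Finset.mem_insert.mp hi with rfl | hi
          · simp
          · have := Finset.mem_Icc.mp (hS hi)
            exact Finset.mem_Icc.mpr (by omega)
        · intro i hi hi'
          rw [Finset.mem_insert] at hi hi'
          rcases hi with rfl | hi
          · rcases hi' with h | h
            · omega
            · have := hb _ h; omega
          · rcases hi' with h | h
            · have := hb _ hi; omega
            · exact hst i hi h
        · rw [Finset.sum_insert hnot, ← hsum, Finset.sum_range_succ, Finset.sum_range_succ]
          have := hy (l + 1)
          simp only [show l + 1 + 1 = l + 2 from rfl] at this hz ⊢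
          omega

lemma ZMod.sum_eq_sum_range {k : ℕ} [NeZero k] (f : ZMod k → ℕ) :
    ∑ a, f a = ∑ i ∈ Finset.range k, f i := by
  refine Finset.sum_bij' (fun a _ => a.val) (fun i _ => (i : ZMod k)) ?_ ?_ ?_ ?_ ?_
  · intro a _; exact Finset.mem_range.mpr a.val_lt
  · simp
  · simp
  · intro i hi; exact ZMod.val_cast_of_lt (Finset.mem_range.mp hi)
  · simp

lemma ZMod.natCast_inj_of_lt {k a b : ℕ} (ha : a < k) (hb : b < k)
    (h : (a : ZMod k) = b) : a = b := by
  rw [ZMod.natCast_eq_natCast_iff', Nat.mod_eq_of_lt ha, Nat.mod_eq_of_lt hb] at h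
  exact h

lemma sum_le_of_cyclic_residual {k : ℕ} [NeZero k] (n z : ZMod k → ℕ) (N : ℕ)
    (hS : ∀ S : Finset (ZMod k), (∀ i ∈ S, i + 1 ∉ S) → ∑ i ∈ S, n i ≤ N)
    (hsum : ∑ i, n i ≤ 2 * N) (hz : ∀ a, z (a + 1) = n (a + 1) - z a) :
    ∑ i, z i ≤ N := by
  classical
  by_cases hj : ∃ j, z j = 0
  · obtain ⟨j, hj⟩ := hj
    obtain ⟨S, hSI, hst, hsumS⟩ := exists_stable_sum_eq (fun i => n (j + i)) (fun i => z (j + i))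
      (by simpa using hj) (fun i => by push_cast; rw [← add_assoc]; exact hz _) (k - 1)
    have hk : 0 < k := Nat.pos_of_ne_zero (NeZero.ne k)
    have hb : ∀ i ∈ S, 1 ≤ i ∧ i < k := fun i hi => by
      have := Finset.mem_Icc.mp (hSI hi); omega
    rw [Nat.sub_add_cancel hk] at hsumS
    have hshift : ∑ i, z i = ∑ i, z (j + i) := (Equiv.sum_comp (Equiv.addLeft j) z).symm
    rw [hshift, ZMod.sum_eq_sum_range (fun i => z (j + i)), hsumS]
    have hinj : Set.InjOn (fun i : ℕ => j + (i : ZMod k)) S := by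
      intro a ha b hb' hab
      exact ZMod.natCast_inj_of_lt (hb a ha).2 (hb b hb').2 (add_left_cancel hab)
    rw [← Finset.sum_image (f := n) hinj]
    refine hS _ ?_
    intro i hi hi'
    obtain ⟨a, ha, rfl⟩ := Finset.mem_image.mp hi
    obtain ⟨b, hb', hab⟩ := Finset.mem_image.mp hi'
    have hab : ((b : ℕ) : ZMod k) = ((a + 1 : ℕ) : ZMod k) := by
      push_cast
      rw [add_assoc] at hab
      exact add_left_cancel hab
    have h1 := hb a ha
    have h2 := hb b hb'
    by_cases hak : a + 1 = k
    · rw [hak, ZMod.natCast_self, ← Nat.cast_zero] at hab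
      have := ZMod.natCast_inj_of_lt h2.2 hk hab
      omega
    · have := ZMod.natCast_inj_of_lt h2.2 (by omega) hab
      subst this
      exact hst a ha hb'
  · push Not at hj
    have hn : ∀ a, n (a + 1) = z (a + 1) + z a := fun a => by
      have := hz a
      have := hj (a + 1)
      omega
    have h1 : ∑ i, n i = ∑ i, n (i + 1) := (Equiv.sum_comp (Equiv.addRight 1) n).symm
    have h2 : ∑ i, z i = ∑ i, z (i + 1) := (Equiv.sum_comp (Equiv.addRight 1) z).symm
    simp only [hn, Finset.sum_add_distrib] at h1
    omega

/-- Weights on an odd cycle can be covered by `N` edges as soon as `N` is at least the weight of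
every stable set and at least half of the total weight. -/
lemma exists_edge_cover {k : ℕ} (hk : Odd k) [NeZero k] (n : ZMod k → ℕ) (N : ℕ)
    (hS : ∀ S : Finset (ZMod k), (∀ i ∈ S, i + 1 ∉ S) → ∑ i ∈ S, n i ≤ N)
    (hsum : ∑ i, n i ≤ 2 * N) :
    ∃ x : ZMod k → ℕ, (∀ a, n (a + 1) ≤ x a + x (a + 1)) ∧ ∑ i, x i ≤ N := by
  let w : ℕ → ℕ := fun i => n ((i : ZMod k) + 1)
  have hval : ∀ a : ZMod k, w a.val = n (a + 1) := fun a => by simp [w]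
  have hsucc : ∀ a : ZMod k, (a.val + 1 < k ∧ (a + 1).val = a.val + 1) ∨
      (a.val + 1 = k ∧ (a + 1).val = 0) := fun a => by
    have hlt := a.val_lt
    have h : (a + 1).val = (a.val + 1) % k := by
      rw [← ZMod.val_natCast]; simp
    by_cases h' : a.val + 1 = k
    · exact Or.inr ⟨h', by rw [h, h', Nat.mod_self]⟩
    · exact Or.inl ⟨by omega, by rw [h, Nat.mod_eq_of_lt (by omega)]⟩
  rcases residualSeq_fixed_or_swap w hk with ⟨t, ht⟩ | ⟨t, ht, ht'⟩
  · have hz : ∀ a : ZMod k, residualSeq w t (a + 1).val = n (a + 1) - residualSeq w t a.val := by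
      intro a
      rw [← hval]
      rcases hsucc a with ⟨_, h⟩ | ⟨h', h⟩
      · rw [h]; rfl
      · rw [h]
        have : residualSeq w t (a.val + 1) = w a.val - residualSeq w t a.val := rfl
        rw [← this, h', ht]; rfl
    exact ⟨fun a => residualSeq w t a.val, fun a => by have := hz a; grind,
      sum_le_of_cyclic_residual n _ N hS hsum hz⟩
  · have htight := (residualSeq_succ_start w t k).2.2 (by omega)
    refine ⟨fun a => residualSeq w (t + 1) a.val, fun a => ?_, ?_⟩
    · have h1 := htight a.val a.val_lt
      rw [hval] at h1
      rcases hsucc a with ⟨_, h⟩ | ⟨h', h⟩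
      · simp only [h]; omega
      · simp only [h]
        rw [h', ht'] at h1
        simp only [residualSeq]
        omega
    · have h1 : ∑ i, n i = ∑ i ∈ Finset.range k, w i := by
        rw [← Equiv.sum_comp (Equiv.addRight 1) n]
        exact ZMod.sum_eq_sum_range (fun i => n (i + 1))
      have h2 : ∑ i ∈ Finset.range k, w i = ∑ i ∈ Finset.range k, residualSeq w (t + 1) i +
          ∑ i ∈ Finset.range k, residualSeq w (t + 1) (i + 1) := by
        rw [← Finset.sum_add_distrib]
        exact Finset.sum_congr rfl fun i hi => (htight i (Finset.mem_range.mp hi)).symm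
      have h3 := Finset.sum_range_succ (residualSeq w (t + 1)) k
      rw [Finset.sum_range_succ', ht'] at h3
      have h4 : residualSeq w (t + 1) 0 = t + 1 := rfl
      have h5 : ∑ a : ZMod k, residualSeq w (t + 1) a.val =
          ∑ i ∈ Finset.range k, residualSeq w (t + 1) i := by
        rw [ZMod.sum_eq_sum_range fun a : ZMod k => residualSeq w (t + 1) a.val]
        exact Finset.sum_congr rfl fun i hi => by
          rw [ZMod.val_cast_of_lt (Finset.mem_range.mp hi)]
      change ∑ a : ZMod k, residualSeq w (t + 1) a.val ≤ N
      omega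

lemma stable_sum_alternating {m : ℕ} (n : ZMod (2 * m + 1) → ℕ) {N : ℕ}
    (hS : ∀ S : Finset (ZMod (2 * m + 1)), (∀ i ∈ S, i + 1 ∉ S) → ∑ i ∈ S, n i ≤ N)
    (a : ZMod (2 * m + 1)) :
    ∑ j ∈ Finset.range m, n (a + (2 * j : ℕ)) ≤ N := by
  classical
  have hinj : Set.InjOn (fun j : ℕ => a + ((2 * j : ℕ) : ZMod (2 * m + 1)))
      (Finset.range m) := by
    intro i hi j hj h
    have hi := Finset.mem_range.mp hi
    have hj := Finset.mem_range.mp hj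
    have := ZMod.natCast_inj_of_lt (by omega) (by omega) (add_left_cancel h)
    omega
  rw [← Finset.sum_image (f := n) hinj]
  refine hS _ fun i hi hi' => ?_
  obtain ⟨b, hb, rfl⟩ := Finset.mem_image.mp hi
  obtain ⟨c, hc, hbc⟩ := Finset.mem_image.mp hi'
  have hb := Finset.mem_range.mp hb
  have hc := Finset.mem_range.mp hc
  rw [add_assoc] at hbc
  have h := add_left_cancel hbc
  have h : ((2 * c : ℕ) : ZMod (2 * m + 1)) = ((2 * b + 1 : ℕ) : ZMod (2 * m + 1)) := by
    rw [h]; push_cast; rfl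
  have := ZMod.natCast_inj_of_lt (by omega) (by omega) h
  omega

lemma mul_sum_le_of_stable_sum_le {m : ℕ} (n : ZMod (2 * m + 1) → ℕ) {N : ℕ}
    (hS : ∀ S : Finset (ZMod (2 * m + 1)), (∀ i ∈ S, i + 1 ∉ S) → ∑ i ∈ S, n i ≤ N) :
    m * ∑ i, n i ≤ (2 * m + 1) * N := by
  have h := Finset.sum_le_sum fun a (_ : a ∈ Finset.univ) => stable_sum_alternating n hS a
  rw [Finset.sum_comm] at h
  have h' : ∀ j ∈ Finset.range m, ∑ a, n (a + (2 * j : ℕ)) = ∑ a, n a :=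
    fun j _ => Equiv.sum_comp (Equiv.addRight ((2 * j : ℕ) : ZMod (2 * m + 1))) n
  rw [Finset.sum_congr rfl h'] at h
  simpa [ZMod.card] using h

lemma le_ringG {m s N : ℕ} (hm : 2 ≤ m) (h : m * s ≤ (2 * m + 1) * N) :
    N ≤ ringG (2 * m + 1) N ∧ s ≤ 2 * ringG (2 * m + 1) N := by
  have hdm := Nat.div_add_mod N (2 * m)
  have hr := Nat.mod_lt N (show 0 < 2 * m by omega)
  unfold ringG
  rw [show 2 * m + 1 - 1 = 2 * m by omega, show (2 * m + 1 - 3) / 2 = m - 1 by omega,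
    show 2 * m + 1 - 2 = 2 * m - 1 by omega]
  generalize N % (2 * m) = r at *
  generalize N / (2 * m) = q at *
  have hkN : (2 * m + 1) * N = r + 2 * m * (N + q) := by rw [mul_add (2 * m)]; linarith
  rw [hkN] at h ⊢
  split_ifs with hle
  · rw [Nat.add_mul_div_left _ _ (by omega), Nat.div_eq_of_lt hr]
    refine ⟨by omega, ?_⟩
    by_contra! hc
    have : m * (2 * (0 + (N + q)) + 1) ≤ m * s := Nat.mul_le_mul_left _ hc
    have : r < m := by omega
    nlinarith
  · rw [show r + 2 * m * (N + q) + (2 * m - 1) = (r - 1) + 2 * m * (N + q + 1) by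
      rw [mul_add (2 * m) (N + q) 1]; omega, Nat.add_mul_div_left _ _ (by omega),
      Nat.div_eq_of_lt (by omega)]
    refine ⟨by omega, ?_⟩
    by_contra! hc
    have : m * (2 * (0 + (N + q + 1)) + 1) ≤ m * s := Nat.mul_le_mul_left _ hc
    nlinarith

namespace IsHyperantiholePartition

variable {V : Type} [Fintype V] {A : SimpleGraph V} {k : ℕ} {X : ZMod k → Set V}

lemma stable_sum_le_cliqueNum (hX : IsHyperantiholePartition A k X) (S : Finset (ZMod k))
    (hS : ∀ i ∈ S, i + 1 ∉ S) : ∑ i ∈ S, (X i).ncard ≤ A.cliqueNum := by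
  classical
  obtain ⟨-, hpart, hclique, hcomp, -⟩ := hX
  have hcard : (S.biUnion fun i => (X i).toFinset).card = ∑ i ∈ S, (X i).ncard := by
    rw [Finset.card_biUnion]
    · simp [Set.ncard_eq_toFinset_card']
    · intro i _ j _ hij
      rw [Function.onFun, Set.disjoint_toFinset, Set.disjoint_left]
      exact fun v hi hj => hij ((hpart v).unique hi hj)
  rw [← hcard]
  refine SimpleGraph.IsClique.card_le_cliqueNum (tc := ?_)
  intro u hu v hv huv
  simp only [Finset.coe_biUnion, Set.coe_toFinset, Set.mem_iUnion, SetLike.mem_coe] at hu hv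
  obtain ⟨i, hi, hui⟩ := hu
  obtain ⟨j, hj, hvj⟩ := hv
  by_cases hij : i = j
  · subst hij
    exact hclique i hui hvj huv
  · refine hcomp i u hui v ?_
    rintro ((h | h) | h)
    · have := (hpart v).unique hvj h
      exact hS j hj (by rwa [this, sub_add_cancel])
    · exact hij ((hpart v).unique h hvj)
    · exact hS i hi ((hpart v).unique h hvj ▸ hj)

lemma colorable_of_edge_cover [NeZero k] (hk : k ≠ 1) (hX : IsHyperantiholePartition A k X)
    (x : ZMod k → ℕ) (hx : ∀ a, (X (a + 1)).ncard ≤ x a + x (a + 1)) :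
    A.Colorable (∑ i, x i) := by
  classical
  obtain ⟨-, hpart, -, -, hanti⟩ := hX
  choose p hp using fun v => (hpart v).exists
  have hemb : ∀ i, Nonempty (X i ↪ Fin (x (i - 1)) ⊕ Fin (x i)) := fun i => by
    rw [Function.Embedding.nonempty_iff_card_le]
    have := hx (i - 1)
    rw [sub_add_cancel, Set.ncard_eq_toFinset_card', Set.toFinset_card] at this
    simpa using this
  let e := fun i => (hemb i).some
  let toColor : ∀ i, Fin (x (i - 1)) ⊕ Fin (x i) → Σ i, Fin (x i) :=
    fun i => Sum.elim (fun c => ⟨i - 1, c⟩) (fun c => ⟨i, c⟩)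
  have hfst : ∀ i s, (toColor i s).1 = i - 1 ∨ (toColor i s).1 = i := by
    rintro i (s | s)
    · exact Or.inl rfl
    · exact Or.inr rfl
  have hone : (1 : ZMod k) ≠ 0 := fun h => hk <| Nat.dvd_one.mp <|
    (ZMod.natCast_eq_zero_iff 1 k).mp (by simpa using h)
  have hmk : ∀ i, Function.Injective fun c : Fin (x i) => (⟨i, c⟩ : Σ i, Fin (x i)) :=
    fun i a b h => by simpa using h
  have hinj : ∀ i, Function.Injective (toColor i) := fun i =>
    Function.Injective.sumElim (hmk _) (hmk _) fun a b h => by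
      have h := congrArg Sigma.fst h
      exact hone (by simpa using h)
  have hsame : ∀ i j u v (hu : u ∈ X i) (hv : v ∈ X j), i = j →
      toColor i (e i ⟨u, hu⟩) = toColor j (e j ⟨v, hv⟩) → u = v := by
    rintro i _ u v hu hv rfl h
    exact congrArg Subtype.val ((e i).injective (hinj i h))
  let C : A.Coloring (Σ i, Fin (x i)) := SimpleGraph.Coloring.mk
    (fun v => toColor (p v) (e (p v) ⟨v, hp v⟩)) <| by
      intro u v huv hc
      by_cases hij : p u = p v
      · exact huv.ne (hsame _ _ u v (hp u) (hp v) hij hc)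
      · have h1 := hfst (p u) (e (p u) ⟨u, hp u⟩)
        have h2 := hfst (p v) (e (p v) ⟨v, hp v⟩)
        rw [hc] at h1
        refine hanti (p u) u (hp u) v ?_ huv
        rcases h1 with h1 | h1 <;> rcases h2 with h2 | h2 <;> rw [h1] at h2
        · exact absurd (sub_left_injective h2) hij
        · exact Or.inl (h2 ▸ hp v)
        · refine Or.inr ?_
          rw [h2, sub_add_cancel]
          exact hp v
        · exact absurd h2 hij
  simpa using C.colorable

end IsHyperantiholePartition

/-- For odd `k ≥ 5`, every `k`-hyperantihole `A` satisfies `ω(A) ≥ (k-1)/2` and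
`χ(A) ≤ g_k(ω(A))`. -/
theorem hyperantihole_chromaticNumber_le {V : Type} [Fintype V]
    (k : ℕ) (hk : 5 ≤ k) (hko : Odd k)
    (A : SimpleGraph V) (hA : IsHyperantihole A k) :
    (k - 1) / 2 ≤ A.cliqueNum ∧
    A.chromaticNumber ≤ (ringG k A.cliqueNum : ℕ∞) := by
  classical
  obtain ⟨X, hX⟩ := hA
  obtain ⟨m, rfl⟩ := hko
  have hS := hX.stable_sum_le_cliqueNum
  constructor
  · refine le_trans ?_ (stable_sum_alternating (fun i => (X i).ncard) hS 0)
    have hpos : ∀ i, 1 ≤ (X i).ncard := fun i => (Set.ncard_pos (Set.toFinite _)).mpr (hX.1 i)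
    have := Finset.card_nsmul_le_sum (Finset.range m)
      (fun j => (X (0 + (2 * j : ℕ))).ncard) 1 fun j _ => hpos _
    simp only [Finset.card_range, smul_eq_mul, mul_one] at this
    omega
  · obtain ⟨hN, hsum⟩ := le_ringG (by omega)
      (mul_sum_le_of_stable_sum_le (fun i => (X i).ncard) hS)
    obtain ⟨x, hx, hxN⟩ := exists_edge_cover ⟨m, rfl⟩ (fun i => (X i).ncard) _
      (fun S h => (hS S h).trans hN) hsum
    exact ((hX.colorable_of_edge_cover (by omega) x hx).mono hxN).chromaticNumber_le
end
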